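/- arXiv:1703.01530 — 2 statements merged into one kernel-verified Lean document; each statement's English description precedes it below -/
import Mathlib

section
/- (Quantitative openness/embedding of A_∞ into A_p.) There exists a dimensional constant c_n such that for every weight w ∈ A_∞ and every p > e^{c_n [w]_{A_∞}}, one has w ∈ A_p with [w]_{A_p} ≤ e^{e^{c_n [w]_{A_∞}}}. -/
open MeasureTheory ENNReal NNReal

noncomputable section

/-- An axis-parallel cube in `ℝⁿ`. -/
def IsCube {n : ℕ} (Q : Set (Fin n → ℝ)) : Prop :=
  ∃ (a : Fin n → ℝ) (h : ℝ), 0 < h ∧ Q = {x | ∀ i, a i ≤ x i ∧ x i ≤ a i + h}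

/-- Average `(1/|Q|) ∫_Q f` of an `ℝ≥0∞`-valued function over a set. -/
def cubeAvg {n : ℕ} (f : (Fin n → ℝ) → ℝ≥0∞) (Q : Set (Fin n → ℝ)) : ℝ≥0∞ :=
  (∫⁻ x in Q, f x) / MeasureTheory.volume Q

/-- The uncentered Hardy–Littlewood maximal operator over axis-parallel cubes,
for `ℝ≥0∞`-valued functions. -/
def hlM {n : ℕ} (f : (Fin n → ℝ) → ℝ≥0∞) (x : Fin n → ℝ) : ℝ≥0∞ :=
  ⨆ (Q : Set (Fin n → ℝ)) (_ : IsCube Q) (_ : x ∈ Q), cubeAvg f Q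

/-- The Hardy–Littlewood maximal operator applied to a real-valued function:
`Mf(x) = sup_{Q ∋ x} (1/|Q|) ∫_Q |f|`. -/
def hlMR {n : ℕ} (f : (Fin n → ℝ) → ℝ) : (Fin n → ℝ) → ℝ≥0∞ :=
  hlM (fun y => ENNReal.ofReal |f y|)

/-- A weight: a locally integrable, a.e. positive function. -/
def IsWeight {n : ℕ} (w : (Fin n → ℝ) → ℝ) : Prop :=
  MeasureTheory.LocallyIntegrable w MeasureTheory.volume ∧
    ∀ᵐ x ∂(MeasureTheory.volume : MeasureTheory.Measure (Fin n → ℝ)), 0 < w x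

/-- `w(E) = ∫_E w dx`. -/
def wMeas {n : ℕ} (w : (Fin n → ℝ) → ℝ) (E : Set (Fin n → ℝ)) : ℝ≥0∞ :=
  ∫⁻ x in E, ENNReal.ofReal (w x)

/-- The `A₁` constant `[w]_{A₁} = ess sup_x M w(x) / w(x)`. -/
def a1Const {n : ℕ} (w : (Fin n → ℝ) → ℝ) : ℝ≥0∞ :=
  essSup (fun x => hlM (fun y => ENNReal.ofReal (w y)) x / ENNReal.ofReal (w x))
    MeasureTheory.volume

/-- The Fujii–Wilson `A_∞` constant `[w]_{A_∞} = sup_Q (1/∫_Q w) ∫_Q M(w·1_Q)`. -/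
def aInfConst {n : ℕ} (w : (Fin n → ℝ) → ℝ) : ℝ≥0∞ :=
  ⨆ (Q : Set (Fin n → ℝ)) (_ : IsCube Q),
    (∫⁻ x in Q, hlM (Q.indicator fun y => ENNReal.ofReal (w y)) x) / wMeas w Q

/-- The `A_p` constant, `1 < p < ∞`:
`[w]_{A_p} = sup_Q ⟨w⟩_Q (⟨w^{-1/(p-1)}⟩_Q)^{p-1}`. -/
def apConst {n : ℕ} (p : ℝ) (w : (Fin n → ℝ) → ℝ) : ℝ≥0∞ :=
  ⨆ (Q : Set (Fin n → ℝ)) (_ : IsCube Q),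
    cubeAvg (fun y => ENNReal.ofReal (w y)) Q *
      (cubeAvg (fun y => ENNReal.ofReal (w y) ^ (-(1 / (p - 1)))) Q) ^ (p - 1)

/-- The weak norm `‖g‖_{L^{1,∞}(σ)} = sup_{t>0} t · σ({x : g(x) > t})`
for an `ℝ≥0∞`-valued function `g` and a weight `σ`. -/
def wkNorm {n : ℕ} (g : (Fin n → ℝ) → ℝ≥0∞) (σ : (Fin n → ℝ) → ℝ) : ℝ≥0∞ :=
  ⨆ (t : ℝ≥0) (_ : 0 < t), (t : ℝ≥0∞) * wMeas σ {x | (t : ℝ≥0∞) < g x}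

/-- `‖f‖_{L¹(σ)} = ∫ |f| σ dx`. -/
def l1Norm {n : ℕ} (f : (Fin n → ℝ) → ℝ) (σ : (Fin n → ℝ) → ℝ) : ℝ≥0∞ :=
  ∫⁻ x, ENNReal.ofReal |f x| * ENNReal.ofReal (σ x)

/-- `‖g‖_{L^p(σ)} = (∫ g^p σ dx)^{1/p}` for an `ℝ≥0∞`-valued `g`. -/
def lpNormE {n : ℕ} (p : ℝ) (g : (Fin n → ℝ) → ℝ≥0∞) (σ : (Fin n → ℝ) → ℝ) : ℝ≥0∞ :=
  (∫⁻ x, g x ^ p * ENNReal.ofReal (σ x)) ^ (1 / p)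

/-- A bounded, compactly supported measurable function. -/
def BddCompSupp {n : ℕ} (f : (Fin n → ℝ) → ℝ) : Prop :=
  Measurable f ∧ (∃ C : ℝ, ∀ x, |f x| ≤ C) ∧ HasCompactSupport f

end

open Set Filter Topology

section Cubes

variable {n : ℕ}

/-- The closed cube with lower corner `a` and side length `h`. -/
def closedCube (a : Fin n → ℝ) (h : ℝ) : Set (Fin n → ℝ) :=
  {x | ∀ i, a i ≤ x i ∧ x i ≤ a i + h}

/-- The half-open cube with lower corner `a` and side length `h`. -/
def halfOpenCube (a : Fin n → ℝ) (h : ℝ) : Set (Fin n → ℝ) :=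
  {x | ∀ i, a i ≤ x i ∧ x i < a i + h}

lemma isCube_closedCube (a : Fin n → ℝ) {h : ℝ} (hh : 0 < h) : IsCube (closedCube a h) :=
  ⟨a, h, hh, rfl⟩

lemma closedCube_eq_Icc (a : Fin n → ℝ) (h : ℝ) :
    closedCube a h = Icc a (fun i => a i + h) := by
  ext x
  simp [closedCube, Pi.le_def, forall_and]

lemma halfOpenCube_eq_pi (a : Fin n → ℝ) (h : ℝ) :
    halfOpenCube a h = pi univ fun i => Ico (a i) (a i + h) := by
  ext x
  simp [halfOpenCube]

lemma halfOpenCube_ae_eq_closedCube (a : Fin n → ℝ) (h : ℝ) :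
    halfOpenCube a h =ᵐ[volume] closedCube a h := by
  rw [halfOpenCube_eq_pi, closedCube_eq_Icc]
  exact Measure.univ_pi_Ico_ae_eq_Icc

lemma halfOpenCube_subset_closedCube (a : Fin n → ℝ) (h : ℝ) :
    halfOpenCube a h ⊆ closedCube a h := fun _ hx i => ⟨(hx i).1, (hx i).2.le⟩

lemma measurableSet_closedCube (a : Fin n → ℝ) (h : ℝ) : MeasurableSet (closedCube a h) := by
  rw [closedCube_eq_Icc]
  exact measurableSet_Icc

lemma measurableSet_halfOpenCube (a : Fin n → ℝ) (h : ℝ) : MeasurableSet (halfOpenCube a h) := by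
  rw [halfOpenCube_eq_pi]
  exact MeasurableSet.univ_pi fun _ => measurableSet_Ico

lemma volume_closedCube (a : Fin n → ℝ) (h : ℝ) :
    volume (closedCube a h) = ENNReal.ofReal h ^ n := by
  rw [closedCube_eq_Icc, Real.volume_Icc_pi]
  simp

lemma volume_halfOpenCube (a : Fin n → ℝ) (h : ℝ) :
    volume (halfOpenCube a h) = ENNReal.ofReal h ^ n := by
  rw [measure_congr (halfOpenCube_ae_eq_closedCube a h), volume_closedCube]

lemma setLIntegral_halfOpenCube (f : (Fin n → ℝ) → ℝ≥0∞) (a : Fin n → ℝ) (h : ℝ) :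
    ∫⁻ x in halfOpenCube a h, f x = ∫⁻ x in closedCube a h, f x :=
  setLIntegral_congr (halfOpenCube_ae_eq_closedCube a h)

lemma volume_closedCube_ne_zero (a : Fin n → ℝ) {h : ℝ} (hh : 0 < h) :
    volume (closedCube a h) ≠ 0 := by
  rw [volume_closedCube]
  exact pow_ne_zero _ (by simpa using hh)

lemma volume_closedCube_ne_top (a : Fin n → ℝ) (h : ℝ) :
    volume (closedCube a h) ≠ ∞ := by
  rw [volume_closedCube]
  exact ENNReal.pow_ne_top ENNReal.ofReal_ne_top

lemma closedCube_subset_of_halfOpenCube_subset {a b : Fin n → ℝ} {h k : ℝ} (hh : 0 < h)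
    (hs : halfOpenCube a h ⊆ halfOpenCube b k) : closedCube a h ⊆ closedCube b k := by
  have hcl : ∀ (c : Fin n → ℝ) (l : ℝ), 0 < l → closure (halfOpenCube c l) = closedCube c l := by
    intro c l hl
    have hne : ∀ i, closure (Ico (c i) (c i + l)) = Icc (c i) (c i + l) := fun i =>
      closure_Ico (by linarith)
    rw [halfOpenCube_eq_pi, closure_pi_set]
    ext x
    simp [hne, closedCube, Pi.le_def, forall_and]
  have hsub : halfOpenCube a h ⊆ closedCube b k := hs.trans (halfOpenCube_subset_closedCube b k)
  rw [← hcl a h hh]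
  refine closure_minimal hsub ?_
  rw [closedCube_eq_Icc]
  exact isClosed_Icc

lemma closedCube_eq_closedBall (a : Fin n → ℝ) {h : ℝ} (hh : 0 < h) :
    closedCube a h = Metric.closedBall (fun i => a i + h / 2) (h / 2) := by
  ext x
  rw [Metric.mem_closedBall, dist_pi_le_iff (by positivity)]
  refine forall_congr' fun i => ?_
  rw [Real.dist_eq, abs_le]
  constructor <;> rintro ⟨h1, h2⟩ <;> constructor <;> linarith

/-- The lower corner of the dyadic subcube of generation `k` (relative to the cube with corner `a`
and side `h`) containing `x`. -/
noncomputable def dyadicCorner (a : Fin n → ℝ) (h : ℝ) (k : ℕ) (x : Fin n → ℝ) : Fin n → ℝ :=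
  fun i => a i + ⌊(x i - a i) / (h / 2 ^ k)⌋ * (h / 2 ^ k)

lemma mem_halfOpenCube_dyadicCorner (a : Fin n → ℝ) {h : ℝ} (hh : 0 < h) (k : ℕ)
    (x : Fin n → ℝ) : x ∈ halfOpenCube (dyadicCorner a h k x) (h / 2 ^ k) := by
  intro i
  have hs : 0 < h / 2 ^ k := by positivity
  have h1 := Int.floor_le ((x i - a i) / (h / 2 ^ k))
  have h2 := Int.lt_floor_add_one ((x i - a i) / (h / 2 ^ k))
  rw [le_div_iff₀ hs] at h1
  rw [div_lt_iff₀ hs] at h2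
  unfold dyadicCorner
  constructor <;> linarith

lemma dyadicCorner_zero (a : Fin n → ℝ) {h : ℝ} (hh : 0 < h) {x : Fin n → ℝ}
    (hx : x ∈ halfOpenCube a h) : dyadicCorner a h 0 x = a := by
  funext i
  have : ⌊(x i - a i) / (h / 2 ^ 0)⌋ = 0 := by
    rw [Int.floor_eq_zero_iff]
    have := hx i
    constructor
    · exact div_nonneg (by linarith) (by positivity)
    · rw [div_lt_one (by positivity)]
      simp
      linarith
  simp only [dyadicCorner, this]
  simp

lemma dyadicCorner_congr_same (a : Fin n → ℝ) {h : ℝ} (hh : 0 < h) {k : ℕ} {x y : Fin n → ℝ}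
    (hy : y ∈ halfOpenCube (dyadicCorner a h k x) (h / 2 ^ k)) (i : Fin n) :
    ⌊(y i - a i) / (h / 2 ^ k)⌋ = ⌊(x i - a i) / (h / 2 ^ k)⌋ := by
  have hs : 0 < h / 2 ^ k := by positivity
  have := hy i
  unfold dyadicCorner at this
  rw [Int.floor_eq_iff]
  rw [le_div_iff₀ hs, div_lt_iff₀ hs]
  constructor <;> linarith

lemma floor_div_succ (a : Fin n → ℝ) {h : ℝ} (k : ℕ) (x : Fin n → ℝ) (i : Fin n) :
    ⌊(x i - a i) / (h / 2 ^ k)⌋ = ⌊(x i - a i) / (h / 2 ^ (k + 1))⌋ / 2 := by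
  have : (x i - a i) / (h / 2 ^ k) = (x i - a i) / (h / 2 ^ (k + 1)) / ((2 : ℕ) : ℝ) := by
    rw [pow_succ]
    push_cast
    field_simp
  rw [this, Int.floor_div_natCast]
  simp

lemma dyadicCorner_congr (a : Fin n → ℝ) {h : ℝ} (hh : 0 < h) {j k : ℕ} (hjk : j ≤ k)
    {x y : Fin n → ℝ} (hy : y ∈ halfOpenCube (dyadicCorner a h k x) (h / 2 ^ k)) :
    dyadicCorner a h j y = dyadicCorner a h j x := by
  funext i
  suffices ⌊(y i - a i) / (h / 2 ^ j)⌋ = ⌊(x i - a i) / (h / 2 ^ j)⌋ by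
    simp only [dyadicCorner, this]
  induction hjk using Nat.decreasingInduction with
  | self => exact dyadicCorner_congr_same a hh hy i
  | of_succ m _ ih => rw [floor_div_succ, ih, ← floor_div_succ]

lemma halfOpenCube_dyadicCorner_subset (a : Fin n → ℝ) {h : ℝ} (hh : 0 < h) {j k : ℕ}
    (hjk : j ≤ k) (x : Fin n → ℝ) :
    halfOpenCube (dyadicCorner a h k x) (h / 2 ^ k) ⊆
      halfOpenCube (dyadicCorner a h j x) (h / 2 ^ j) := by
  intro y hy
  rw [← dyadicCorner_congr a hh hjk hy]
  exact mem_halfOpenCube_dyadicCorner a hh j y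

/-- **Calderón–Zygmund stopping cubes** for an arbitrary selection rule `B` on cubes. -/
lemma exists_stopping_cubes (a : Fin n → ℝ) {h : ℝ} (hh : 0 < h) (B : (Fin n → ℝ) → ℝ → Prop)
    (hB : ¬ B a h) :
    ∃ S : Set ((Fin n → ℝ) × ℝ), S.Countable ∧
      S.PairwiseDisjoint (fun q => halfOpenCube q.1 q.2) ∧
      (∀ q ∈ S, 0 < q.2 ∧ closedCube q.1 q.2 ⊆ closedCube a h ∧ B q.1 q.2 ∧
        ∃ b, ¬ B b (2 * q.2) ∧ closedCube q.1 q.2 ⊆ closedCube b (2 * q.2)) ∧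
      ∀ x ∈ halfOpenCube a h, x ∉ (⋃ q ∈ S, halfOpenCube q.1 q.2) → ∀ k : ℕ,
        ∃ b, x ∈ closedCube b (h / 2 ^ k) ∧ closedCube b (h / 2 ^ k) ⊆ closedCube a h ∧
          ¬ B b (h / 2 ^ k) := by
  set c := dyadicCorner a h with hc
  refine ⟨{q | ∃ x ∈ halfOpenCube a h, ∃ k, q = (c k x, h / 2 ^ k) ∧ B (c k x) (h / 2 ^ k) ∧
    ∀ j < k, ¬ B (c j x) (h / 2 ^ j)}, ?_, ?_, ?_, ?_⟩
  · refine (countable_range (fun p : ℕ × (Fin n → ℤ) =>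
      ((fun i => a i + p.2 i * (h / 2 ^ p.1), h / 2 ^ p.1) : (Fin n → ℝ) × ℝ))).mono ?_
    rintro q ⟨x, -, k, rfl, -⟩
    exact ⟨(k, fun i => ⌊(x i - a i) / (h / 2 ^ k)⌋), rfl⟩
  · rintro q ⟨x, -, k, rfl, hBk, hmin⟩ q' ⟨x', -, k', rfl, hBk', hmin'⟩ hne
    refine Set.disjoint_left.2 fun y hy hy' => hne ?_
    have e : ∀ j ≤ k, c j y = c j x := fun j hj => dyadicCorner_congr a hh hj hy
    have e' : ∀ j ≤ k', c j y = c j x' := fun j hj => dyadicCorner_congr a hh hj hy'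
    have hkk : k = k' := by
      rcases lt_trichotomy k k' with hlt | heq | hlt
      · exact absurd (by rwa [← e' k hlt.le, e k le_rfl]) (hmin' k hlt)
      · exact heq
      · exact absurd (by rwa [← e k' hlt.le, e' k' le_rfl]) (hmin k' hlt)
    subst hkk
    rw [← e k le_rfl, ← e' k le_rfl]
  · rintro q ⟨x, hx, k, rfl, hBk, hmin⟩
    have hk : k ≠ 0 := by
      rintro rfl
      rw [hc, dyadicCorner_zero a hh hx] at hBk
      simp at hBk
      exact hB hBk
    obtain ⟨m, rfl⟩ := Nat.exists_eq_succ_of_ne_zero hk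
    have h2 : 2 * (h / 2 ^ (m + 1)) = h / 2 ^ m := by
      rw [pow_succ]
      field_simp
    have hp : 0 < h / 2 ^ (m + 1) := by positivity
    refine ⟨hp, closedCube_subset_of_halfOpenCube_subset hp ?_, hBk, c m x, ?_, ?_⟩
    · have := halfOpenCube_dyadicCorner_subset a hh (Nat.zero_le (m + 1)) x
      rw [dyadicCorner_zero a hh hx] at this
      simpa using this
    · simp only [Nat.succ_eq_add_one, h2]
      exact hmin m (Nat.lt_succ_self m)
    · simp only [Nat.succ_eq_add_one, h2]
      exact closedCube_subset_of_halfOpenCube_subset hp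
        (halfOpenCube_dyadicCorner_subset a hh (Nat.le_succ m) x)
  · intro x hx hxS k
    have hp : 0 < h / 2 ^ k := by positivity
    refine ⟨c k x, halfOpenCube_subset_closedCube _ _ (mem_halfOpenCube_dyadicCorner a hh k x),
      closedCube_subset_of_halfOpenCube_subset hp ?_, ?_⟩
    · have := halfOpenCube_dyadicCorner_subset a hh (Nat.zero_le k) x
      rw [dyadicCorner_zero a hh hx] at this
      simpa using this
    · intro hBk
      classical
      have hex : ∃ k, B (c k x) (h / 2 ^ k) := ⟨k, hBk⟩
      refine hxS (mem_iUnion₂.2 ⟨(c (Nat.find hex) x, h / 2 ^ Nat.find hex), ?_, ?_⟩)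
      · exact ⟨x, hx, Nat.find hex, rfl, Nat.find_spec hex, fun j hj => Nat.find_min hex hj⟩
      · exact mem_halfOpenCube_dyadicCorner a hh _ x

/-- Lebesgue differentiation along shrinking subcubes of a fixed cube. -/
lemma ae_tendsto_cubeAvg {f : (Fin n → ℝ) → ℝ≥0∞} (hf : Measurable f) (a : Fin n → ℝ) {h : ℝ}
    (hh : 0 < h) (hfin : ∫⁻ x in closedCube a h, f x ≠ ∞) :
    ∀ᵐ x, x ∈ closedCube a h → ∀ b : ℕ → Fin n → ℝ,
      (∀ k, x ∈ closedCube (b k) (h / 2 ^ k)) →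
      (∀ k, closedCube (b k) (h / 2 ^ k) ⊆ closedCube a h) →
      Tendsto (fun k => cubeAvg f (closedCube (b k) (h / 2 ^ k))) atTop (𝓝 (f x)) := by
  have hm := measurableSet_closedCube a h
  have key := VitaliFamily.ae_tendsto_lintegral_div
    (IsUnifLocDoublingMeasure.vitaliFamily (volume : Measure (Fin n → ℝ)) 1)
    (f := (closedCube a h).indicator f) (hf.indicator hm).aemeasurable
    (by rwa [lintegral_indicator hm])
  filter_upwards [key] with x hx hxa b hxb hb
  have hlim : Tendsto (fun k : ℕ => h / 2 ^ k / 2) atTop (𝓝[>] 0) := by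
    refine tendsto_nhdsWithin_iff.2 ⟨?_, Eventually.of_forall fun k => ?_⟩
    · have : Tendsto (fun k : ℕ => (h / 2) * (1 / 2 : ℝ) ^ k) atTop (𝓝 ((h / 2) * 0)) :=
        (_root_.tendsto_pow_atTop_nhds_zero_of_lt_one (by norm_num) (by norm_num)).const_mul _
      rw [mul_zero] at this
      refine this.congr fun k => ?_
      rw [one_div, inv_pow]
      field_simp
    · exact mem_Ioi.2 (by positivity)
  have ht := IsUnifLocDoublingMeasure.tendsto_closedBall_filterAt
    (volume : Measure (Fin n → ℝ)) (K := 1) (x := x) (l := atTop)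
    (fun k i => b k i + h / 2 ^ k / 2) (fun k => h / 2 ^ k / 2) hlim
    (Eventually.of_forall fun k => by
      rw [one_mul, ← closedCube_eq_closedBall (b k) (by positivity)]
      exact hxb k)
  have := hx.comp ht
  rw [indicator_of_mem hxa] at this
  refine this.congr fun k => ?_
  simp only [Function.comp]
  rw [← closedCube_eq_closedBall (b k) (by positivity), cubeAvg,
    setLIntegral_indicator hm, inter_eq_self_of_subset_right (hb k)]

end Cubes

section LevelSets

variable {n : ℕ} {f : (Fin n → ℝ) → ℝ≥0∞}

lemma setLIntegral_biUnion_halfOpenCube (f : (Fin n → ℝ) → ℝ≥0∞)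
    {S : Set ((Fin n → ℝ) × ℝ)} (hS : S.Countable)
    (hd : S.PairwiseDisjoint (fun q => halfOpenCube q.1 q.2)) :
    ∫⁻ x in ⋃ q ∈ S, halfOpenCube q.1 q.2, f x = ∑' q : S, ∫⁻ x in closedCube q.1.1 q.1.2, f x := by
  rw [lintegral_biUnion hS (fun q _ => measurableSet_halfOpenCube q.1 q.2) hd]
  simp_rw [setLIntegral_halfOpenCube]

lemma volume_biUnion_halfOpenCube {S : Set ((Fin n → ℝ) × ℝ)} (hS : S.Countable)
    (hd : S.PairwiseDisjoint (fun q => halfOpenCube q.1 q.2)) :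
    volume (⋃ q ∈ S, halfOpenCube q.1 q.2) = ∑' q : S, volume (closedCube q.1.1 q.1.2) := by
  rw [measure_biUnion hS hd (fun q _ => measurableSet_halfOpenCube q.1 q.2)]
  simp_rw [volume_closedCube, volume_halfOpenCube]

lemma biUnion_halfOpenCube_subset {S : Set ((Fin n → ℝ) × ℝ)} {Q : Set (Fin n → ℝ)}
    (hS : ∀ q ∈ S, closedCube q.1 q.2 ⊆ Q) : ⋃ q ∈ S, halfOpenCube q.1 q.2 ⊆ Q :=
  iUnion₂_subset fun q hq => (halfOpenCube_subset_closedCube _ _).trans (hS q hq)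

lemma volume_closedCube_two_mul (a b : Fin n → ℝ) (h : ℝ) :
    volume (closedCube b (2 * h)) = 2 ^ n * volume (closedCube a h) := by
  rw [volume_closedCube, volume_closedCube, ENNReal.ofReal_mul (by norm_num), mul_pow]
  simp

lemma cubeAvg_mul_volume (f : (Fin n → ℝ) → ℝ≥0∞) (a : Fin n → ℝ) {h : ℝ} (hh : 0 < h) :
    cubeAvg f (closedCube a h) * volume (closedCube a h) = ∫⁻ x in closedCube a h, f x :=
  ENNReal.div_mul_cancel (volume_closedCube_ne_zero a hh) (volume_closedCube_ne_top a h)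

lemma cubeAvg_le_iff (f : (Fin n → ℝ) → ℝ≥0∞) (a : Fin n → ℝ) {h : ℝ} (hh : 0 < h) {t : ℝ≥0∞} :
    cubeAvg f (closedCube a h) ≤ t ↔
      ∫⁻ x in closedCube a h, f x ≤ t * volume (closedCube a h) :=
  ENNReal.div_le_iff (volume_closedCube_ne_zero a hh) (volume_closedCube_ne_top a h)

/-- Reverse weak-type estimate for the local maximal function at one level. -/
lemma exists_subset_hlM_ge (hf : Measurable f) (a : Fin n → ℝ) {h : ℝ} (hh : 0 < h)
    (hfin : ∫⁻ x in closedCube a h, f x ≠ ∞) {t : ℝ≥0∞}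
    (ht : cubeAvg f (closedCube a h) ≤ t) :
    ∃ G, MeasurableSet G ∧ G ⊆ closedCube a h ∧
      (∀ x ∈ G, t ≤ hlM ((closedCube a h).indicator f) x) ∧
      ∫⁻ x in closedCube a h ∩ {x | t < f x}, f x ≤ 2 ^ n * t * volume G := by
  obtain ⟨S, hSc, hSd, hS, hout⟩ := exists_stopping_cubes a hh
    (fun b l => t < cubeAvg f (closedCube b l)) (not_lt.2 ht)
  refine ⟨⋃ q ∈ S, halfOpenCube q.1 q.2,
    MeasurableSet.biUnion hSc fun q _ => measurableSet_halfOpenCube _ _,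
    biUnion_halfOpenCube_subset fun q hq => (hS q hq).2.1, ?_, ?_⟩
  · intro x hx
    obtain ⟨q, hq, hxq⟩ := mem_iUnion₂.1 hx
    obtain ⟨hq0, hsub, hB, -⟩ := hS q hq
    refine hB.le.trans ?_
    have e : cubeAvg f (closedCube q.1 q.2) =
        cubeAvg ((closedCube a h).indicator f) (closedCube q.1 q.2) := by
      rw [cubeAvg, cubeAvg, setLIntegral_indicator (measurableSet_closedCube a h),
        inter_eq_self_of_subset_right hsub]
    rw [e]
    exact le_iSup₂_of_le _ (isCube_closedCube q.1 hq0)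
      (le_iSup_of_le (halfOpenCube_subset_closedCube _ _ hxq) le_rfl)
  · have hsub : (closedCube a h ∩ {x | t < f x} : Set (Fin n → ℝ)) ≤ᵐ[volume]
        (⋃ q ∈ S, halfOpenCube q.1 q.2 : Set (Fin n → ℝ)) := by
      filter_upwards [ae_tendsto_cubeAvg hf a hh hfin,
        (halfOpenCube_ae_eq_closedCube a h).mem_iff] with x hx hx' hxm
      obtain ⟨hxa, hxt⟩ := hxm
      by_contra hxS
      choose b hb1 hb2 hb3 using hout x (hx'.2 hxa) hxS
      exact absurd (le_of_tendsto' (hx hxa b hb1 hb2) fun k => not_lt.1 (hb3 k)) (not_le.2 hxt)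
    calc ∫⁻ x in closedCube a h ∩ {x | t < f x}, f x
        ≤ ∫⁻ x in ⋃ q ∈ S, halfOpenCube q.1 q.2, f x := lintegral_mono_set' hsub
      _ = ∑' q : S, ∫⁻ x in closedCube q.1.1 q.1.2, f x :=
          setLIntegral_biUnion_halfOpenCube f hSc hSd
      _ ≤ ∑' q : S, 2 ^ n * t * volume (closedCube q.1.1 q.1.2) := by
          refine ENNReal.tsum_le_tsum fun q => ?_
          obtain ⟨hq0, -, -, b, hb, hqb⟩ := hS q.1 q.2
          refine (lintegral_mono_set hqb).trans ?_
          have := (cubeAvg_le_iff f b (by linarith)).1 (not_lt.1 hb)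
          rw [volume_closedCube_two_mul q.1.1] at this
          exact this.trans_eq (by ring)
      _ = 2 ^ n * t * volume (⋃ q ∈ S, halfOpenCube q.1 q.2) := by
          rw [ENNReal.tsum_mul_left, volume_biUnion_halfOpenCube hSc hSd]

lemma sum_indicator_two_pow_le {α : Type*} (G : ℕ → Set α) (m M : ℝ≥0∞) (x : α)
    (hM : ∀ k, x ∈ G k → 2 ^ k * m ≤ M) (K : ℕ) :
    ∑ k ∈ Finset.range K, (G k).indicator (fun _ => 2 ^ k * m) x ≤ 2 * M := by
  have geom : ∀ K : ℕ, ∑ k ∈ Finset.range K, (2 : ℝ≥0∞) ^ k * m ≤ 2 ^ K * m := by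
    intro K
    induction K with
    | zero => simp
    | succ K ih =>
      rw [Finset.sum_range_succ, pow_succ, mul_assoc, two_mul, mul_add]
      gcongr
  induction K with
  | zero => simp
  | succ K ih =>
    by_cases hx : x ∈ G K
    · calc ∑ k ∈ Finset.range (K + 1), (G k).indicator (fun _ => 2 ^ k * m) x
          ≤ ∑ k ∈ Finset.range (K + 1), 2 ^ k * m :=
            Finset.sum_le_sum fun k _ => indicator_le_self _ _ _
        _ ≤ 2 ^ (K + 1) * m := geom _
        _ = 2 * (2 ^ K * m) := by rw [pow_succ]; ring
        _ ≤ 2 * M := by gcongr; exact hM K hx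
    · rw [Finset.sum_range_succ, indicator_of_notMem hx, add_zero]
      exact ih

/-- Logarithmic decay of the mass on high level sets, from the local maximal function bound. -/
lemma nat_mul_setLIntegral_le (hf : Measurable f) (a : Fin n → ℝ) {h : ℝ} (hh : 0 < h)
    (hfin : ∫⁻ x in closedCube a h, f x ≠ ∞) (K : ℕ) :
    K * ∫⁻ x in closedCube a h ∩ {x | 2 ^ K * cubeAvg f (closedCube a h) < f x}, f x ≤
      2 ^ (n + 1) * ∫⁻ x in closedCube a h, hlM ((closedCube a h).indicator f) x := by
  set m := cubeAvg f (closedCube a h) with hm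
  have hle : ∀ k : ℕ, m ≤ 2 ^ k * m := fun k =>
    le_mul_of_one_le_left (zero_le) (one_le_pow₀ (by norm_num))
  choose G hGm hGs hGM hG using fun k : ℕ => exists_subset_hlM_ge hf a hh hfin (hle k)
  calc K * ∫⁻ x in closedCube a h ∩ {x | 2 ^ K * m < f x}, f x
      = ∑ k ∈ Finset.range K, ∫⁻ x in closedCube a h ∩ {x | 2 ^ K * m < f x}, f x := by simp
    _ ≤ ∑ k ∈ Finset.range K, 2 ^ n * (2 ^ k * m) * volume (G k) := by
        refine Finset.sum_le_sum fun k hk => le_trans (lintegral_mono_set ?_) (hG k)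
        refine inter_subset_inter_right _
          (ofPred_subset_ofPred.2 fun x hx => lt_of_le_of_lt ?_ hx)
        gcongr
        · norm_num
        · exact (Finset.mem_range.1 hk).le
    _ = 2 ^ n * ∫⁻ x in closedCube a h,
          ∑ k ∈ Finset.range K, (G k).indicator (fun _ => 2 ^ k * m) x := by
        rw [lintegral_finsetSum _ fun k _ => measurable_const.indicator (hGm k), Finset.mul_sum]
        refine Finset.sum_congr rfl fun k _ => ?_
        rw [setLIntegral_indicator (hGm k), inter_eq_self_of_subset_left (hGs k),
          setLIntegral_const, mul_assoc]
    _ ≤ 2 ^ n * ∫⁻ x in closedCube a h, 2 * hlM ((closedCube a h).indicator f) x := by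
        gcongr with x
        exact sum_indicator_two_pow_le G m _ x (fun k => hGM k x) K
    _ = 2 ^ (n + 1) * ∫⁻ x in closedCube a h, hlM ((closedCube a h).indicator f) x := by
        rw [lintegral_const_mul' _ _ (by norm_num), pow_succ, mul_assoc]

/-- Sets of small Lebesgue measure carry at most half of the mass. -/
lemma two_mul_setLIntegral_le_of_volume_le (hf : Measurable f) (a : Fin n → ℝ) {h : ℝ}
    (hh : 0 < h) (hfin : ∫⁻ x in closedCube a h, f x ≠ ∞) {A : ℕ} (hA : A ≠ 0)
    (hM : ∫⁻ x in closedCube a h, hlM ((closedCube a h).indicator f) x ≤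
      A * ∫⁻ x in closedCube a h, f x)
    {E : Set (Fin n → ℝ)} (hEs : E ⊆ closedCube a h)
    (hvol : volume E ≤ (2 ^ (2 ^ (n + 3) * A + 2))⁻¹ * volume (closedCube a h)) :
    2 * ∫⁻ x in E, f x ≤ ∫⁻ x in closedCube a h, f x := by
  set K := 2 ^ (n + 3) * A with hK
  set W := ∫⁻ x in closedCube a h, f x with hW
  set m := cubeAvg f (closedCube a h) with hm
  set T := 2 ^ K * m with hT
  have hmV : m * volume (closedCube a h) = W := cubeAvg_mul_volume f a hh
  have high : 4 * ∫⁻ x in closedCube a h ∩ {x | T < f x}, f x ≤ W := by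
    have h1 := (nat_mul_setLIntegral_le hf a hh hfin K).trans (mul_le_mul_right hM _)
    have hc0 : (2 ^ (n + 1) * A : ℝ≥0∞) ≠ 0 := by simp [hA]
    have hct : (2 ^ (n + 1) * A : ℝ≥0∞) ≠ ∞ :=
      ENNReal.mul_ne_top (ENNReal.pow_ne_top (by norm_num)) (ENNReal.natCast_ne_top A)
    rw [← ENNReal.mul_le_mul_iff_right hc0 hct]
    refine le_trans (le_of_eq ?_) (h1.trans (le_of_eq ?_))
    · rw [hK]
      push_cast
      ring
    · ring
  have low : 4 * ∫⁻ x in E ∩ {x | f x ≤ T}, f x ≤ W := by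
    have h2 : ∫⁻ x in E ∩ {x | f x ≤ T}, f x ≤ T * volume E := by
      calc ∫⁻ x in E ∩ {x | f x ≤ T}, f x ≤ ∫⁻ x in E ∩ {x | f x ≤ T}, T :=
            setLIntegral_mono measurable_const fun x hx => hx.2
        _ ≤ T * volume E := by
            rw [setLIntegral_const]
            gcongr
            exact inter_subset_left
    have hc : (2 ^ (K + 2) : ℝ≥0∞) * (2 ^ (K + 2))⁻¹ = 1 :=
      ENNReal.mul_inv_cancel (by simp) (ENNReal.pow_ne_top (by norm_num))
    calc 4 * ∫⁻ x in E ∩ {x | f x ≤ T}, f x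
        ≤ 4 * (T * ((2 ^ (K + 2))⁻¹ * volume (closedCube a h))) := by
          gcongr
          exact h2.trans (by gcongr)
      _ = (2 ^ (K + 2) * (2 ^ (K + 2))⁻¹) * (m * volume (closedCube a h)) := by
          rw [hT, pow_add]
          ring
      _ = W := by rw [hc, one_mul, hmV]
  have split : ∫⁻ x in E, f x ≤
      (∫⁻ x in E ∩ {x | f x ≤ T}, f x) + ∫⁻ x in closedCube a h ∩ {x | T < f x}, f x := by
    refine le_trans (lintegral_mono_set fun x hx => ?_) (lintegral_union_le _ _ _)
    rcases le_or_gt (f x) T with hxT | hxT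
    · exact Or.inl ⟨hx, hxT⟩
    · exact Or.inr ⟨hEs hx, hxT⟩
  have : 2 * (2 * ∫⁻ x in E, f x) ≤ 2 * W := by
    calc 2 * (2 * ∫⁻ x in E, f x) = 4 * ∫⁻ x in E, f x := by ring
      _ ≤ 4 * (∫⁻ x in E ∩ {x | f x ≤ T}, f x) +
          4 * ∫⁻ x in closedCube a h ∩ {x | T < f x}, f x := by
          rw [← mul_add]
          gcongr
      _ ≤ W + W := add_le_add low high
      _ = 2 * W := by ring
  rwa [ENNReal.mul_le_mul_iff_right (by norm_num) (by norm_num)] at this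

/-- Doubling from the small-set estimate, by growing the inner cube in thin layers. -/
lemma setLIntegral_le_two_pow_mul (hfin : ∀ (a : Fin n → ℝ) (h : ℝ),
      ∫⁻ x in closedCube a h, f x ≠ ∞) {θ : ℝ}
    (hsmall : ∀ (a : Fin n → ℝ) (h : ℝ), 0 < h → ∀ E, MeasurableSet E → E ⊆ closedCube a h →
      volume E ≤ ENNReal.ofReal θ * volume (closedCube a h) →
      2 * ∫⁻ x in E, f x ≤ ∫⁻ x in closedCube a h, f x)
    {N : ℕ} (hN : 0 < N) (hNθ : n ≤ N * θ) {a b : Fin n → ℝ} {h : ℝ} (hh : 0 < h)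
    (hsub : closedCube a h ⊆ closedCube b (2 * h)) :
    ∫⁻ x in closedCube b (2 * h), f x ≤ 2 ^ N * ∫⁻ x in closedCube a h, f x := by
  have hab : ∀ i, b i ≤ a i ∧ a i + h ≤ b i + 2 * h := by
    have h1 := hsub (show a ∈ closedCube a h from fun i => ⟨le_rfl, by linarith⟩)
    have h2 := hsub (show (fun i => a i + h) ∈ closedCube a h from
      fun i => ⟨by linarith, le_rfl⟩)
    exact fun i => ⟨(h1 i).1, (h2 i).2⟩
  have hNr : (0 : ℝ) < N := by exact_mod_cast hN
  set R : ℕ → Set (Fin n → ℝ) := fun j =>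
    closedCube (fun i => a i + (j / N : ℝ) * (b i - a i)) (h * (1 + j / N)) with hR
  have step : ∀ j, ∫⁻ x in R (j + 1), f x ≤ 2 * ∫⁻ x in R j, f x := by
    intro j
    have hj0 : (0 : ℝ) ≤ j / N := by positivity
    have hj1 : ((j + 1 : ℕ) / N : ℝ) = j / N + 1 / N := by push_cast; ring
    have hN1 : (0 : ℝ) < 1 / N := by positivity
    have hs0 : 0 < h * (1 + j / N) := by positivity
    have hs1 : 0 < h * (1 + (j + 1 : ℕ) / N) := by positivity
    have hmono : R j ⊆ R (j + 1) := by
      intro x hx i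
      obtain ⟨hx1, hx2⟩ := hx i
      obtain ⟨ha1, ha2⟩ := hab i
      have e1 : (1 / N : ℝ) * (b i - a i) ≤ 0 :=
        mul_nonpos_of_nonneg_of_nonpos hN1.le (by linarith)
      have e2 : 0 ≤ (1 / N : ℝ) * (b i + h - a i) := mul_nonneg hN1.le (by linarith)
      simp only [hj1]
      constructor <;> nlinarith
    have hmR : MeasurableSet (R j) := measurableSet_closedCube _ _
    have hvol : volume (R (j + 1) \ R j) ≤ ENNReal.ofReal θ * volume (R (j + 1)) := by
      rw [measure_sdiff hmono hmR.nullMeasurableSet (volume_closedCube_ne_top _ _)]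
      simp only [hR, volume_closedCube]
      rw [← ENNReal.ofReal_pow hs0.le, ← ENNReal.ofReal_pow hs1.le,
        ← ENNReal.ofReal_sub _ (by positivity), ← ENNReal.ofReal_mul' (by positivity)]
      refine ENNReal.ofReal_le_ofReal ?_
      set s := h * (1 + j / N) with hs
      set s' := h * (1 + (j + 1 : ℕ) / N) with hs'
      have hNge : (1 : ℝ) ≤ N := by exact_mod_cast hN
      have h1N : (1 / N : ℝ) ≤ 1 := by rw [div_le_one hNr]; exact hNge
      have hss : (1 - 1 / N) * s' ≤ s := by
        rw [hs, hs', hj1]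
        have : 0 ≤ h * (1 / N) * (j / N + 1 / N) := by positivity
        nlinarith
      have hbern : 1 - (n : ℝ) / N ≤ (1 - 1 / N) ^ n := by
        have := one_add_mul_le_pow (a := -(1 / N : ℝ)) (by linarith) n
        calc 1 - (n : ℝ) / N = 1 + n * -(1 / N : ℝ) := by ring
          _ ≤ (1 + -(1 / N : ℝ)) ^ n := this
          _ = _ := by ring
      have hnN : (n : ℝ) / N ≤ θ := by
        rw [div_le_iff₀ hNr]
        linarith
      have hpow : (1 - 1 / N) ^ n * s' ^ n ≤ s ^ n := by
        rw [← mul_pow]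
        exact pow_le_pow_left₀ (mul_nonneg (by linarith) hs1.le) hss n
      have hs'n : 0 < s' ^ n := by positivity
      nlinarith
    have hE := hsmall _ _ hs1 (R (j + 1) \ R j)
      ((measurableSet_closedCube _ _).diff hmR) sdiff_subset hvol
    have hsplit : ∫⁻ x in R (j + 1), f x =
        (∫⁻ x in R j, f x) + ∫⁻ x in R (j + 1) \ R j, f x := by
      rw [← lintegral_inter_add_sdiff f (R (j + 1)) hmR, inter_eq_self_of_subset_right hmono]
    have hX : ∫⁻ x in R (j + 1), f x ≠ ∞ := hfin _ _
    refine (ENNReal.add_le_add_iff_right hX).1 ?_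
    calc (∫⁻ x in R (j + 1), f x) + ∫⁻ x in R (j + 1), f x
        = 2 * (∫⁻ x in R j, f x) + 2 * ∫⁻ x in R (j + 1) \ R j, f x := by
          rw [hsplit]
          ring
      _ ≤ 2 * (∫⁻ x in R j, f x) + ∫⁻ x in R (j + 1), f x := by gcongr
  have all : ∀ j, ∫⁻ x in R j, f x ≤ 2 ^ j * ∫⁻ x in R 0, f x := by
    intro j
    induction j with
    | zero => simp
    | succ j ih =>
      refine (step j).trans ?_
      rw [pow_succ', mul_assoc]
      gcongr
  have h0 : R 0 = closedCube a h := by simp [hR]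
  have hNN : R N = closedCube b (2 * h) := by
    simp only [hR, div_self hNr.ne']
    congr 1
    · funext i
      ring
    · ring
  rw [← h0, ← hNN]
  exact all N

/-- Geometric decay of the measure of low level sets. -/
lemma volume_lt_pow_mul_cubeAvg_le (hf : Measurable f) (hfin : ∀ (a : Fin n → ℝ) (h : ℝ),
      ∫⁻ x in closedCube a h, f x ≠ ∞) {ρ : ℝ≥0∞} {N : ℕ}
    (hρ : ∀ (a : Fin n → ℝ) (h : ℝ), 0 < h → ∀ F, MeasurableSet F → F ⊆ closedCube a h →
      4 * ∫⁻ x in F, f x ≤ ∫⁻ x in closedCube a h, f x →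
      volume F ≤ ρ * volume (closedCube a h))
    (hdoub : ∀ (a b : Fin n → ℝ) (h : ℝ), 0 < h → closedCube a h ⊆ closedCube b (2 * h) →
      ∫⁻ x in closedCube b (2 * h), f x ≤ 2 ^ N * ∫⁻ x in closedCube a h, f x)
    (k : ℕ) (a : Fin n → ℝ) {h : ℝ} (hh : 0 < h) :
    volume (closedCube a h ∩ {x | f x < ((2 ^ (N + 2))⁻¹) ^ k * cubeAvg f (closedCube a h)}) ≤
      ρ ^ k * volume (closedCube a h) := by
  induction k generalizing a h with
  | zero =>
    refine (measure_mono inter_subset_left).trans ?_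
    rw [pow_zero, one_mul]
  | succ k ih =>
    set m := cubeAvg f (closedCube a h) with hm
    set μ : ℝ≥0∞ := (2 ^ (N + 2))⁻¹ with hμ
    have hμ4 : μ = (2 ^ N)⁻¹ * 4⁻¹ := by
      rw [hμ, pow_add, ENNReal.mul_inv (by simp) (by simp)]
      norm_num
    have hμle : μ ≤ 4⁻¹ := by
      rw [hμ4]
      refine mul_le_of_le_one_left (zero_le) ?_
      exact ENNReal.inv_le_one.2 (one_le_pow₀ (by norm_num))
    have hμ1 : μ ≤ 1 := hμle.trans (ENNReal.inv_le_one.2 (by norm_num))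
    obtain ⟨S, hSc, hSd, hS, hout⟩ := exists_stopping_cubes a hh
      (fun b l => cubeAvg f (closedCube b l) < 4⁻¹ * m)
      (not_lt.2 (mul_le_of_le_one_left (zero_le) (ENNReal.inv_le_one.2 (by norm_num))))
    set G := ⋃ q ∈ S, halfOpenCube q.1 q.2 with hG
    have hGs : G ⊆ closedCube a h := biUnion_halfOpenCube_subset fun q hq => (hS q hq).2.1
    have hGvol : volume G ≤ ρ * volume (closedCube a h) := by
      refine hρ a h hh G (MeasurableSet.biUnion hSc fun q _ => measurableSet_halfOpenCube _ _)
        hGs ?_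
      calc 4 * ∫⁻ x in G, f x = 4 * ∑' q : S, ∫⁻ x in closedCube q.1.1 q.1.2, f x := by
            rw [setLIntegral_biUnion_halfOpenCube f hSc hSd]
        _ ≤ 4 * ∑' q : S, 4⁻¹ * m * volume (closedCube q.1.1 q.1.2) := by
            gcongr with q
            obtain ⟨hq0, -, hB, -⟩ := hS q.1 q.2
            exact (cubeAvg_le_iff f _ hq0).1 hB.le
        _ = (4 * 4⁻¹) * (m * volume G) := by
            rw [ENNReal.tsum_mul_left, hG, volume_biUnion_halfOpenCube hSc hSd]
            ring
        _ ≤ m * volume (closedCube a h) := by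
            rw [ENNReal.mul_inv_cancel (by norm_num) (by norm_num), one_mul]
            gcongr
        _ = ∫⁻ x in closedCube a h, f x := cubeAvg_mul_volume f a hh
    have havg : ∀ q ∈ S, μ * m ≤ cubeAvg f (closedCube q.1 q.2) := by
      intro q hq
      obtain ⟨hq0, -, -, b, hb, hqb⟩ := hS q hq
      calc μ * m = (2 ^ N)⁻¹ * (4⁻¹ * m) := by rw [hμ4, mul_assoc]
        _ ≤ (2 ^ N)⁻¹ * cubeAvg f (closedCube b (2 * q.2)) := by
            gcongr
            exact not_lt.1 hb
        _ ≤ (2 ^ N)⁻¹ * ((2 ^ N * ∫⁻ x in closedCube q.1 q.2, f x) /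
              volume (closedCube q.1 q.2)) := by
            rw [cubeAvg]
            gcongr
            exact hdoub _ _ _ hq0 hqb
        _ = ((2 ^ N)⁻¹ * 2 ^ N) * cubeAvg f (closedCube q.1 q.2) := by
            rw [cubeAvg, mul_div_assoc, mul_assoc]
        _ = cubeAvg f (closedCube q.1 q.2) := by
            rw [ENNReal.inv_mul_cancel (by simp) (ENNReal.pow_ne_top (by norm_num)), one_mul]
    have hsub : (closedCube a h ∩ {x | f x < μ ^ (k + 1) * m} : Set (Fin n → ℝ)) ≤ᵐ[volume]
        (⋃ q ∈ S, closedCube q.1 q.2 ∩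
          {x | f x < μ ^ k * cubeAvg f (closedCube q.1 q.2)} : Set (Fin n → ℝ)) := by
      filter_upwards [ae_tendsto_cubeAvg hf a hh (hfin a h),
        (halfOpenCube_ae_eq_closedCube a h).mem_iff] with x hx hx' hxm
      obtain ⟨hxa, hxt : f x < _⟩ := hxm
      by_cases hxG : x ∈ G
      · obtain ⟨q, hq, hxq⟩ := mem_iUnion₂.1 hxG
        refine mem_iUnion₂.2 ⟨q, hq, halfOpenCube_subset_closedCube _ _ hxq, ?_⟩
        refine lt_of_lt_of_le hxt ?_
        rw [pow_succ, mul_assoc]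
        gcongr
        exact havg q hq
      · choose b hb1 hb2 hb3 using hout x (hx'.2 hxa) hxG
        have h1 := ge_of_tendsto' (hx hxa b hb1 hb2) fun k => not_lt.1 (hb3 k)
        refine absurd (lt_of_lt_of_le hxt ?_) (not_lt.2 h1)
        gcongr
        calc μ ^ (k + 1) ≤ μ ^ 1 := pow_le_pow_of_le_one (zero_le) hμ1 (by omega)
          _ ≤ 4⁻¹ := by rwa [pow_one]
    calc volume (closedCube a h ∩ {x | f x < μ ^ (k + 1) * m})
        ≤ ∑' q : S, volume (closedCube q.1.1 q.1.2 ∩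
            {x | f x < μ ^ k * cubeAvg f (closedCube q.1.1 q.1.2)}) :=
          (measure_mono_ae hsub).trans (measure_biUnion_le _ hSc _)
      _ ≤ ∑' q : S, ρ ^ k * volume (closedCube q.1.1 q.1.2) := by
          gcongr with q
          exact ih q.1.1 (hS q.1 q.2).1
      _ = ρ ^ k * volume G := by
          rw [ENNReal.tsum_mul_left, hG, volume_biUnion_halfOpenCube hSc hSd]
      _ ≤ ρ ^ (k + 1) * volume (closedCube a h) := by
          rw [pow_succ, mul_assoc]
          gcongr

end LevelSets

section NegativePowers

variable {n : ℕ} {f : (Fin n → ℝ) → ℝ≥0∞}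

lemma rpow_neg_le_tsum {y m μ : ℝ≥0∞} (hy : y ≠ 0) (hm : m ≠ ∞)
    (hμ1 : μ < 1) {s : ℝ} (hs : 0 < s) :
    y ^ (-s) ≤ m ^ (-s) * (1 + ∑' k : ℕ, if y < μ ^ k * m then (μ ^ (-s)) ^ (k + 1) else 0) := by
  have anti : ∀ {u v : ℝ≥0∞}, u ≤ v → v ^ (-s) ≤ u ^ (-s) := by
    intro u v huv
    rw [ENNReal.rpow_neg, ENNReal.rpow_neg]
    exact ENNReal.inv_le_inv.2 (ENNReal.rpow_le_rpow huv hs.le)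
  rcases le_or_gt m y with hmy | hmy
  · exact (anti hmy).trans (le_mul_of_one_le_right zero_le le_self_add)
  · have hex : ∃ k : ℕ, μ ^ k * m ≤ y := by
      have ht : Tendsto (fun k : ℕ => μ ^ k * m) atTop (𝓝 (0 * m)) :=
        ENNReal.Tendsto.mul_const (ENNReal.tendsto_pow_atTop_nhds_zero_of_lt_one hμ1)
          (Or.inr hm)
      rw [zero_mul] at ht
      exact ((ht.eventually_lt_const (pos_iff_ne_zero.2 hy)).exists).imp fun _ => le_of_lt
    classical
    obtain ⟨k, hk⟩ : ∃ k, Nat.find hex = k + 1 := by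
      refine Nat.exists_eq_succ_of_ne_zero fun h0 => ?_
      have := Nat.find_spec hex
      rw [h0, pow_zero, one_mul] at this
      exact absurd this (not_le.2 hmy)
    have h1 : μ ^ (k + 1) * m ≤ y := hk ▸ Nat.find_spec hex
    have h2 : y < μ ^ k * m := not_le.1 (Nat.find_min hex (by omega))
    have hμt : μ ≠ ∞ := (hμ1.trans ENNReal.one_lt_top).ne
    calc y ^ (-s) ≤ (μ ^ (k + 1) * m) ^ (-s) := anti h1
      _ = m ^ (-s) * (μ ^ (-s)) ^ (k + 1) := by
        rw [ENNReal.mul_rpow_of_ne_top (ENNReal.pow_ne_top hμt) hm, mul_comm,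
          ← ENNReal.rpow_natCast, ← ENNReal.rpow_natCast, ← ENNReal.rpow_mul,
          ← ENNReal.rpow_mul, mul_comm (-s)]
      _ ≤ m ^ (-s) * (1 + ∑' k : ℕ,
            if y < μ ^ k * m then (μ ^ (-s)) ^ (k + 1) else 0) := by
        gcongr
        refine le_trans ?_ le_add_self
        refine le_trans ?_ (ENNReal.le_tsum k)
        rw [if_pos h2]

/-- Integrability of a small negative power from geometric decay of low level sets. -/
lemma cubeAvg_rpow_neg_le (hf : Measurable f) (hpos : ∀ᵐ x, 0 < f x) (a : Fin n → ℝ) {h : ℝ}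
    (hh : 0 < h) {m μ ρ : ℝ≥0∞} (hm0 : m ≠ 0) (hm : m ≠ ∞) (hμ1 : μ < 1)
    (hdecay : ∀ k : ℕ, volume (closedCube a h ∩ {x | f x < μ ^ k * m}) ≤
      ρ ^ k * volume (closedCube a h)) {s : ℝ} (hs : 0 < s) :
    cubeAvg (fun x => f x ^ (-s)) (closedCube a h) ≤
      m ^ (-s) * (1 + μ ^ (-s) * (1 - μ ^ (-s) * ρ)⁻¹) := by
  rw [cubeAvg_le_iff _ a hh]
  set r := μ ^ (-s) with hr
  set V := volume (closedCube a h) with hV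
  have hms : m ^ (-s) ≠ ∞ := by simp [ENNReal.rpow_eq_top_iff, hm0, hm, hs]
  have hmeas : ∀ k : ℕ, MeasurableSet {x | f x < μ ^ k * m} := fun k =>
    measurableSet_lt hf measurable_const
  calc ∫⁻ x in closedCube a h, f x ^ (-s)
      ≤ ∫⁻ x in closedCube a h,
          m ^ (-s) * (1 + ∑' k : ℕ, if f x < μ ^ k * m then r ^ (k + 1) else 0) := by
        refine lintegral_mono_ae (ae_restrict_of_ae ?_)
        filter_upwards [hpos] with x hx
        exact rpow_neg_le_tsum hx.ne' hm hμ1 hs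
    _ = m ^ (-s) * (V + ∑' k : ℕ, r ^ (k + 1) *
          volume (closedCube a h ∩ {x | f x < μ ^ k * m})) := by
        rw [lintegral_const_mul' _ _ hms, lintegral_add_left measurable_const, setLIntegral_one,
          lintegral_tsum fun k =>
            (Measurable.ite (hmeas k) measurable_const measurable_const).aemeasurable]
        congr 3
        funext k
        have : (fun x => if f x < μ ^ k * m then r ^ (k + 1) else 0) =
            {x | f x < μ ^ k * m}.indicator fun _ => r ^ (k + 1) := by
          funext x
          simp [indicator_apply]
        rw [this, setLIntegral_indicator (hmeas k), setLIntegral_const, inter_comm]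
    _ ≤ m ^ (-s) * (V + ∑' k : ℕ, r * V * (r * ρ) ^ k) := by
        refine mul_le_mul_right (add_le_add_right (ENNReal.tsum_le_tsum fun k => ?_) _) _
        calc r ^ (k + 1) * volume (closedCube a h ∩ {x | f x < μ ^ k * m})
            ≤ r ^ (k + 1) * (ρ ^ k * V) := by
              gcongr
              exact hdecay k
          _ = r * V * (r * ρ) ^ k := by ring
    _ = m ^ (-s) * (1 + r * (1 - r * ρ)⁻¹) * V := by
        rw [ENNReal.tsum_mul_left, ENNReal.tsum_geometric]
        ring

/-- Monotonicity of power means over a cube. -/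
lemma rpow_cubeAvg_rpow_neg_le (hf : Measurable f) (a : Fin n → ℝ) {h : ℝ} (hh : 0 < h)
    {s t : ℝ} (hs : 0 < s) (hst : s ≤ t) :
    cubeAvg (fun x => f x ^ (-s)) (closedCube a h) ^ (1 / s) ≤
      cubeAvg (fun x => f x ^ (-t)) (closedCube a h) ^ (1 / t) := by
  set P : Measure (Fin n → ℝ) :=
    (volume (closedCube a h))⁻¹ • volume.restrict (closedCube a h) with hP
  have : IsProbabilityMeasure P := ⟨by
    rw [hP, Measure.smul_apply, Measure.restrict_apply_univ, smul_eq_mul]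
    exact ENNReal.inv_mul_cancel (volume_closedCube_ne_zero a hh) (volume_closedCube_ne_top a h)⟩
  have key : ∀ u : ℝ, eLpNorm' (fun x => (f x)⁻¹) u P =
      cubeAvg (fun x => f x ^ (-u)) (closedCube a h) ^ (1 / u) := by
    intro u
    simp only [eLpNorm'_eq_lintegral_enorm, enorm_eq_self, ENNReal.inv_rpow, ← ENNReal.rpow_neg]
    rw [hP, lintegral_smul_measure, cubeAvg, smul_eq_mul, mul_comm, ← div_eq_mul_inv]
  rw [← key s, ← key t]
  exact eLpNorm'_le_eLpNorm'_of_exponent_le hs hst P hf.inv.aestronglyMeasurable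

lemma one_add_mul_inv_le {r : ℝ≥0∞} {θ : ℝ} (hθ0 : 0 < θ) (hθ1 : θ ≤ 1)
    (hr : r ≤ ENNReal.ofReal (1 + θ / 2)) :
    1 + r * (1 - r * ENNReal.ofReal (1 - θ))⁻¹ ≤ ENNReal.ofReal (5 / θ) := by
  have h1 : ENNReal.ofReal (θ / 2) ≤ 1 - r * ENNReal.ofReal (1 - θ) := by
    refine ENNReal.le_sub_of_add_le_right ?_ ?_
    · exact ENNReal.mul_ne_top (ne_top_of_le_ne_top ENNReal.ofReal_ne_top hr)
        ENNReal.ofReal_ne_top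
    · calc ENNReal.ofReal (θ / 2) + r * ENNReal.ofReal (1 - θ)
          ≤ ENNReal.ofReal (θ / 2) + ENNReal.ofReal (1 + θ / 2) * ENNReal.ofReal (1 - θ) := by
            gcongr
        _ = ENNReal.ofReal (θ / 2 + (1 + θ / 2) * (1 - θ)) := by
            rw [← ENNReal.ofReal_mul (by positivity), ← ENNReal.ofReal_add (by positivity)
              (mul_nonneg (by positivity) (by linarith))]
        _ ≤ 1 := by
            rw [ENNReal.ofReal_le_one]
            nlinarith
  calc 1 + r * (1 - r * ENNReal.ofReal (1 - θ))⁻¹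
      ≤ 1 + ENNReal.ofReal 2 * (ENNReal.ofReal (θ / 2))⁻¹ := by
        gcongr
        exact hr.trans (ENNReal.ofReal_le_ofReal (by linarith))
    _ = ENNReal.ofReal (1 + 2 * (θ / 2)⁻¹) := by
        rw [← ENNReal.ofReal_inv_of_pos (by positivity), ← ENNReal.ofReal_mul (by norm_num),
          ENNReal.ofReal_add (by norm_num) (by positivity), ENNReal.ofReal_one]
    _ ≤ ENNReal.ofReal (5 / θ) := by
        refine ENNReal.ofReal_le_ofReal ?_
        have : 1 + 2 * (θ / 2)⁻¹ = (θ + 4) / θ := by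
          field_simp
          ring
        rw [this]
        gcongr
        linarith

lemma inv_two_pow_rpow_neg_le (M : ℕ) (hM : 0 < M) {θ : ℝ} (hθ0 : 0 < θ) (hθ1 : θ ≤ 1) :
    ((2 ^ M : ℝ≥0∞)⁻¹) ^ (-(θ / (2 * M))) ≤ ENNReal.ofReal (1 + θ / 2) := by
  have hMr : (0 : ℝ) < M := by exact_mod_cast hM
  rw [ENNReal.inv_rpow, ← ENNReal.rpow_neg, neg_neg, ← ENNReal.rpow_natCast, ← ENNReal.rpow_mul]
  have e : (M : ℝ) * (θ / (2 * M)) = θ / 2 := by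
    field_simp
  have e2 : (2 : ℝ≥0∞) = ENNReal.ofReal 2 := by simp
  rw [e, e2, ENNReal.ofReal_rpow_of_pos (by norm_num)]
  refine ENNReal.ofReal_le_ofReal ?_
  have := rpow_one_add_le_one_add_mul_self (s := 1) (by norm_num) (p := θ / 2)
    (by positivity) (by linarith)
  norm_num at this
  exact this

lemma volume_le_of_four_mul_setLIntegral_le {θ : ℝ} (hθ0 : 0 ≤ θ) (hθ1 : θ ≤ 1)
    (a : Fin n → ℝ) {h : ℝ}
    (hfin : ∫⁻ x in closedCube a h, f x ≠ ∞) (h0 : ∫⁻ x in closedCube a h, f x ≠ 0)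
    (hsmall : ∀ E, MeasurableSet E → E ⊆ closedCube a h →
      volume E ≤ ENNReal.ofReal θ * volume (closedCube a h) →
      2 * ∫⁻ x in E, f x ≤ ∫⁻ x in closedCube a h, f x)
    {F : Set (Fin n → ℝ)} (hF : MeasurableSet F) (hFs : F ⊆ closedCube a h)
    (hF4 : 4 * ∫⁻ x in F, f x ≤ ∫⁻ x in closedCube a h, f x) :
    volume F ≤ ENNReal.ofReal (1 - θ) * volume (closedCube a h) := by
  by_contra! hlt
  set V := volume (closedCube a h) with hV
  set W := ∫⁻ x in closedCube a h, f x with hW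
  have hFfin : volume F ≠ ∞ :=
    ne_top_of_le_ne_top (volume_closedCube_ne_top a h) (measure_mono hFs)
  have hsum : volume F + volume (closedCube a h \ F) = V := by
    rw [hV, ← measure_inter_add_sdiff (closedCube a h) hF, inter_eq_self_of_subset_right hFs]
  have hone : ENNReal.ofReal θ * V + ENNReal.ofReal (1 - θ) * V = V := by
    rw [← add_mul, ← ENNReal.ofReal_add hθ0 (by linarith)]
    simp
  have hvol : volume (closedCube a h \ F) ≤ ENNReal.ofReal θ * V := by
    refine (ENNReal.add_le_add_iff_left hFfin).1 ?_
    rw [hsum, add_comm]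
    calc V = ENNReal.ofReal θ * V + ENNReal.ofReal (1 - θ) * V := hone.symm
      _ ≤ ENNReal.ofReal θ * V + volume F := by gcongr
  have hE := hsmall _ ((measurableSet_closedCube a h).diff hF) sdiff_subset hvol
  have hsplit : W = (∫⁻ x in F, f x) + ∫⁻ x in closedCube a h \ F, f x := by
    rw [hW, ← lintegral_inter_add_sdiff f (closedCube a h) hF, inter_eq_self_of_subset_right hFs]
  have h3 : 3 * W ≠ ∞ := ENNReal.mul_ne_top (by norm_num) hfin
  have : 3 * W + W ≤ 3 * W + 0 := by
    calc 3 * W + W = 4 * W := by ring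
      _ = 4 * (∫⁻ x in F, f x) + 2 * (2 * ∫⁻ x in closedCube a h \ F, f x) := by
        rw [hsplit]
        ring
      _ ≤ W + 2 * W := by gcongr
      _ = 3 * W + 0 := by ring
  exact h0 (nonpos_iff_eq_zero.1 ((ENNReal.add_le_add_iff_left h3).1 this))

/-- The `A_p` bound on one cube, with explicit constants, from a linear bound for the local maximal
function. -/
lemma cubeAvg_mul_rpow_cubeAvg_le (hf : Measurable f) (hpos : ∀ᵐ x, 0 < f x)
    (hfin : ∀ (a : Fin n → ℝ) (h : ℝ), ∫⁻ x in closedCube a h, f x ≠ ∞)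
    (h0 : ∀ (a : Fin n → ℝ) (h : ℝ), 0 < h → ∫⁻ x in closedCube a h, f x ≠ 0)
    {A : ℕ} (hA : A ≠ 0)
    (hM : ∀ (a : Fin n → ℝ) (h : ℝ), 0 < h →
      ∫⁻ x in closedCube a h, hlM ((closedCube a h).indicator f) x ≤
        A * ∫⁻ x in closedCube a h, f x)
    {θ : ℝ} (hθ : θ = (2 ^ (2 ^ (n + 3) * A + 2))⁻¹) {N : ℕ} (hN : 0 < N) (hNθ : n ≤ N * θ)
    {p : ℝ} (hp : 2 * (N + 2 : ℕ) / θ ≤ p - 1) (a : Fin n → ℝ) {h : ℝ} (hh : 0 < h) :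
    cubeAvg f (closedCube a h) *
      (cubeAvg (fun x => f x ^ (-(1 / (p - 1)))) (closedCube a h)) ^ (p - 1) ≤
      ENNReal.ofReal ((5 / θ) ^ (2 * (N + 2 : ℕ) / θ)) := by
  have hθ0 : 0 < θ := by rw [hθ]; positivity
  have hθ1 : θ ≤ 1 := by
    rw [hθ]
    exact inv_le_one_of_one_le₀ (one_le_pow₀ (by norm_num))
  have hθE : ENNReal.ofReal θ = (2 ^ (2 ^ (n + 3) * A + 2))⁻¹ := by
    rw [hθ, ENNReal.ofReal_inv_of_pos (by positivity), ENNReal.ofReal_pow (by norm_num)]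
    simp
  have hsmall : ∀ (a : Fin n → ℝ) (h : ℝ), 0 < h → ∀ E, MeasurableSet E → E ⊆ closedCube a h →
      volume E ≤ ENNReal.ofReal θ * volume (closedCube a h) →
      2 * ∫⁻ x in E, f x ≤ ∫⁻ x in closedCube a h, f x := by
    intro a h hh E _ hEs hvol
    rw [hθE] at hvol
    exact two_mul_setLIntegral_le_of_volume_le hf a hh (hfin a h) hA (hM a h hh) hEs hvol
  set M := N + 2 with hMdef
  have hMr : (0 : ℝ) < (M : ℕ) := by
    rw [hMdef]
    positivity
  set s := θ / (2 * (M : ℕ)) with hs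
  have hs0 : 0 < s := by positivity
  set m := cubeAvg f (closedCube a h) with hm
  have hm0 : m ≠ 0 := (ENNReal.div_pos (h0 a h hh) (volume_closedCube_ne_top a h)).ne'
  have hmt : m ≠ ∞ := ENNReal.div_ne_top (hfin a h) (volume_closedCube_ne_zero a hh)
  have hμ1 : ((2 ^ M : ℝ≥0∞))⁻¹ < 1 := by
    rw [ENNReal.inv_lt_one]
    exact one_lt_pow₀ (by norm_num) (by omega)
  have hdecay := fun k : ℕ => volume_lt_pow_mul_cubeAvg_le hf hfin (ρ := ENNReal.ofReal (1 - θ))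
    (N := N) (fun a h hh F hF hFs hF4 => volume_le_of_four_mul_setLIntegral_le hθ0.le hθ1 a
      (hfin a h) (h0 a h hh) (hsmall a h hh) hF hFs hF4)
    (fun a b h hh hsub => setLIntegral_le_two_pow_mul hfin hsmall hN hNθ hh hsub) k a hh
  have hC : cubeAvg (fun x => f x ^ (-s)) (closedCube a h) ≤
      m ^ (-s) * ENNReal.ofReal (5 / θ) :=
    (cubeAvg_rpow_neg_le hf hpos a hh hm0 hmt hμ1 hdecay hs0).trans
      (mul_le_mul_right (one_add_mul_inv_le hθ0 hθ1
        (inv_two_pow_rpow_neg_le M (by omega) hθ0 hθ1)) _)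
  have hs_inv : 1 / s = 2 * (M : ℕ) / θ := by
    rw [hs]
    field_simp
  have hp0 : 0 < p - 1 := lt_of_lt_of_le (by positivity) hp
  have hle : 1 / (p - 1) ≤ s := by
    rw [div_le_iff₀ hp0, ← div_le_iff₀' hs0, hs_inv]
    exact hp
  have hJ := rpow_cubeAvg_rpow_neg_le hf a hh (one_div_pos.2 hp0) hle
  rw [one_div_one_div] at hJ
  calc m * (cubeAvg (fun x => f x ^ (-(1 / (p - 1)))) (closedCube a h)) ^ (p - 1)
      ≤ m * (m ^ (-s) * ENNReal.ofReal (5 / θ)) ^ (1 / s) := by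
        gcongr
        exact hJ.trans (ENNReal.rpow_le_rpow hC (by positivity))
    _ = m * (m⁻¹ * ENNReal.ofReal (5 / θ) ^ (1 / s)) := by
        rw [ENNReal.mul_rpow_of_nonneg _ _ (by positivity), ← ENNReal.rpow_mul,
          show -s * (1 / s) = -1 by field_simp, ENNReal.rpow_neg_one]
    _ = ENNReal.ofReal ((5 / θ) ^ (2 * (M : ℕ) / θ)) := by
        rw [← mul_assoc, ENNReal.mul_inv_cancel hm0 hmt, one_mul, hs_inv,
          ENNReal.ofReal_rpow_of_pos (by positivity)]

end NegativePowers

section Transfer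

variable {n : ℕ}

lemma cubeAvg_congr_ae {f g : (Fin n → ℝ) → ℝ≥0∞} (hfg : f =ᵐ[volume] g)
    (Q : Set (Fin n → ℝ)) : cubeAvg f Q = cubeAvg g Q := by
  rw [cubeAvg, cubeAvg, lintegral_congr_ae (ae_restrict_of_ae hfg)]

lemma hlM_congr_ae {f g : (Fin n → ℝ) → ℝ≥0∞} (hfg : f =ᵐ[volume] g) : hlM f = hlM g := by
  funext x
  simp only [hlM, cubeAvg_congr_ae hfg]

lemma IsCube.exists_eq_closedCube {Q : Set (Fin n → ℝ)} (hQ : IsCube Q) :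
    ∃ a h, 0 < h ∧ Q = closedCube a h := hQ

lemma IsWeight.wMeas_closedCube_ne_top {w : (Fin n → ℝ) → ℝ} (hw : IsWeight w)
    (a : Fin n → ℝ) (h : ℝ) : wMeas w (closedCube a h) ≠ ∞ := by
  have : IntegrableOn w (closedCube a h) volume := by
    rw [closedCube_eq_Icc]
    exact hw.1.integrableOn_isCompact isCompact_Icc
  exact this.lintegral_lt_top.ne

lemma IsWeight.wMeas_closedCube_ne_zero {w : (Fin n → ℝ) → ℝ} (hw : IsWeight w)
    (a : Fin n → ℝ) {h : ℝ} (hh : 0 < h) : wMeas w (closedCube a h) ≠ 0 := by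
  intro h0
  have hm : AEMeasurable (fun x => ENNReal.ofReal (w x)) (volume.restrict (closedCube a h)) :=
    hw.1.aestronglyMeasurable.aemeasurable.ennreal_ofReal.restrict
  have hz := (lintegral_eq_zero_iff' hm).1 h0
  have hF : ∀ᵐ x ∂volume.restrict (closedCube a h), False := by
    filter_upwards [hz, ae_restrict_of_ae hw.2] with x hx hx'
    exact absurd hx (ENNReal.ofReal_pos.2 hx').ne'
  rw [eventually_false_iff_eq_bot, ae_eq_bot, Measure.restrict_eq_zero] at hF
  exact volume_closedCube_ne_zero a hh hF

lemma lintegral_hlM_le_aInfConst_mul {w : (Fin n → ℝ) → ℝ} (hw : IsWeight w)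
    (a : Fin n → ℝ) {h : ℝ} (hh : 0 < h) :
    ∫⁻ x in closedCube a h, hlM ((closedCube a h).indicator fun y => ENNReal.ofReal (w y)) x ≤
      aInfConst w * wMeas w (closedCube a h) := by
  rw [← ENNReal.div_le_iff (hw.wMeas_closedCube_ne_zero a hh) (hw.wMeas_closedCube_ne_top a h)]
  exact le_iSup₂_of_le (closedCube a h) (isCube_closedCube a hh) le_rfl

lemma one_le_aInfConst {w : (Fin n → ℝ) → ℝ} (hw : IsWeight w) : 1 ≤ aInfConst w := by
  set Q : Set (Fin n → ℝ) := closedCube 0 1 with hQ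
  have hQc : IsCube Q := isCube_closedCube 0 one_pos
  have hW0 : wMeas w Q ≠ 0 := hw.wMeas_closedCube_ne_zero 0 one_pos
  have hWt : wMeas w Q ≠ ∞ := hw.wMeas_closedCube_ne_top 0 1
  refine le_iSup₂_of_le Q hQc ?_
  rw [ENNReal.le_div_iff_mul_le (Or.inl hW0) (Or.inl hWt), one_mul]
  set g : (Fin n → ℝ) → ℝ≥0∞ := Q.indicator fun y => ENNReal.ofReal (w y) with hg
  have hmQ : MeasurableSet Q := measurableSet_closedCube 0 1
  calc wMeas w Q = ∫⁻ x in Q, g x := by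
        rw [hg, setLIntegral_indicator hmQ, inter_self]
        rfl
    _ = ∫⁻ _ in Q, cubeAvg g Q := by
        rw [setLIntegral_const, cubeAvg_mul_volume g 0 one_pos]
    _ ≤ ∫⁻ x in Q, hlM g x := setLIntegral_mono' hmQ fun x hx =>
        le_iSup₂_of_le Q hQc (le_iSup_of_le hx le_rfl)

/-- The explicit constants of `cubeAvg_mul_rpow_cubeAvg_le` are at most exponential in the
`A_∞` constant. -/
lemma explicit_constant_le {A K N : ℕ} {α θ : ℝ} (hα : 1 ≤ α) (hA : (A : ℝ) ≤ 2 * α)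
    (hK : K = 2 ^ (n + 3) * A + 2) (hθ : θ = (2 ^ K)⁻¹) (hN : (N : ℝ) ≤ n / θ + 2) :
    10 * ((N + 2 : ℕ) : ℝ) / θ ^ 2 ≤ Real.exp ((n + 6 + 3 * (2 ^ (n + 4) + 2)) * α) := by
  have hθ0 : 0 < θ := by rw [hθ]; positivity
  have hθ1 : θ ≤ 1 := by
    rw [hθ]
    exact inv_le_one_of_one_le₀ (one_le_pow₀ (by norm_num))
  have hM : ((N + 2 : ℕ) : ℝ) ≤ (n + 4) / θ := by
    have : (4 : ℝ) ≤ 4 / θ := by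
      rw [le_div_iff₀ hθ0]
      linarith
    push_cast
    rw [add_div]
    linarith
  have hn : (10 * (n + 4) : ℝ) ≤ 2 ^ (n + 6) := by
    have h1 : n + 1 ≤ 2 ^ n := Nat.lt_two_pow_self
    have h2 : ((n : ℝ) + 1) ≤ 2 ^ n := by exact_mod_cast h1
    rw [pow_add]
    have : (0 : ℝ) ≤ n := Nat.cast_nonneg n
    linarith
  calc 10 * ((N + 2 : ℕ) : ℝ) / θ ^ 2 ≤ 10 * (((n : ℝ) + 4) / θ) / θ ^ 2 := by gcongr
    _ = 10 * ((n : ℝ) + 4) * (2 ^ K) ^ 3 := by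
      rw [hθ]
      field_simp
    _ ≤ (2 : ℝ) ^ (n + 6) * (2 ^ K) ^ 3 := by gcongr
    _ = (2 : ℝ) ^ (n + 6 + 3 * K) := by
      rw [pow_add _ (n + 6), ← pow_mul, mul_comm K]
    _ ≤ Real.exp 1 ^ (n + 6 + 3 * K) := by
      gcongr
      linarith [Real.add_one_le_exp (1 : ℝ)]
    _ = Real.exp ((n : ℝ) + 6 + 3 * K) := by
      rw [← Real.exp_nat_mul]
      push_cast
      ring_nf
    _ ≤ Real.exp ((n + 6 + 3 * (2 ^ (n + 4) + 2)) * α) := by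
      refine Real.exp_le_exp.2 ?_
      have h1 : (2 : ℝ) ^ (n + 3) * A ≤ 2 ^ (n + 3) * (2 * α) := by gcongr
      have h2 : (n + 6 : ℝ) ≤ (n + 6) * α := le_mul_of_one_le_right (by positivity) hα
      have h3 : (2 : ℝ) ^ (n + 3) * (2 * α) = 2 ^ (n + 4) * α := by ring
      rw [hK]
      push_cast
      nlinarith

end Transfer

/-- **Quantitative embedding `A_∞ ⊆ A_p` (Hytönen–Pérez).** There is a dimensional constant
`c_n` such that every `w ∈ A_∞` belongs to `A_p` for all `p > e^{c_n [w]_{A_∞}}`, with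
`[w]_{A_p} ≤ e^{e^{c_n [w]_{A_∞}}}`. -/
theorem Ainfty_embeds_in_Ap (n : ℕ) :
    ∃ c : ℝ, 0 < c ∧
      ∀ w : (Fin n → ℝ) → ℝ, IsWeight w → aInfConst w ≠ ∞ →
        ∀ p : ℝ, Real.exp (c * (aInfConst w).toReal) < p →
          apConst p w ≤
            ENNReal.ofReal (Real.exp (Real.exp (c * (aInfConst w).toReal))) := by
  refine ⟨n + 6 + 3 * (2 ^ (n + 4) + 2), by positivity, fun w hw hAt p hp => ?_⟩
  set α := (aInfConst w).toReal with hα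
  set E := Real.exp ((n + 6 + 3 * (2 ^ (n + 4) + 2)) * α) with hE
  have hα1 : 1 ≤ α := by
    rw [hα, ← ENNReal.toReal_one]
    exact ENNReal.toReal_mono hAt (one_le_aInfConst hw)
  set A := ⌈α⌉₊ with hA
  have hαA : α ≤ A := Nat.le_ceil α
  have hA0 : A ≠ 0 := (Nat.ceil_pos.2 (by linarith)).ne'
  have hA2 : (A : ℝ) ≤ 2 * α := by
    have := Nat.ceil_lt_add_one (show 0 ≤ α by linarith)
    linarith
  have hAE : aInfConst w ≤ A := by
    rw [← ENNReal.ofReal_toReal hAt, ← ENNReal.ofReal_natCast]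
    exact ENNReal.ofReal_le_ofReal hαA
  set θ : ℝ := (2 ^ (2 ^ (n + 3) * A + 2))⁻¹ with hθ
  have hθ0 : 0 < θ := by positivity
  have hθ1 : θ ≤ 1 := inv_le_one_of_one_le₀ (one_le_pow₀ (by norm_num))
  set N := ⌈n / θ⌉₊ + 1 with hN
  have hN0 : 0 < N := Nat.succ_pos _
  have hNle : (N : ℝ) ≤ n / θ + 2 := by
    have := Nat.ceil_lt_add_one (show 0 ≤ n / θ by positivity)
    rw [hN]
    push_cast
    linarith
  have hNθ : (n : ℝ) ≤ N * θ := by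
    rw [← div_le_iff₀ hθ0, hN]
    push_cast
    linarith [Nat.le_ceil (n / θ)]
  have hconst : 10 * (N + 2 : ℕ) / θ ^ 2 ≤ E := explicit_constant_le hα1 hA2 rfl hθ hNle
  have hM2 : (2 : ℝ) ≤ (N + 2 : ℕ) := by
    push_cast
    linarith [(Nat.cast_nonneg N : (0 : ℝ) ≤ N)]
  have hpN : 2 * (N + 2 : ℕ) / θ ≤ p - 1 := by
    have h1 : 2 * ((N + 2 : ℕ) : ℝ) / θ + 1 ≤ 10 * (N + 2 : ℕ) / θ ^ 2 := by
      rw [div_add_one hθ0.ne', div_le_div_iff₀ hθ0 (by positivity)]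
      have : (2 * ((N + 2 : ℕ) : ℝ) + θ) * θ ≤ 10 * (N + 2 : ℕ) := by nlinarith
      nlinarith
    linarith
  have hbound : (5 / θ) ^ (2 * (N + 2 : ℕ) / θ) ≤ Real.exp E := by
    have h5 : 0 < 5 / θ := by positivity
    rw [Real.rpow_def_of_pos h5]
    refine Real.exp_le_exp.2 (le_trans ?_ hconst)
    calc Real.log (5 / θ) * (2 * (N + 2 : ℕ) / θ) ≤ 5 / θ * (2 * (N + 2 : ℕ) / θ) := by
          gcongr
          linarith [Real.log_le_sub_one_of_pos h5]
      _ = 10 * (N + 2 : ℕ) / θ ^ 2 := by ring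
  have hmeas : AEMeasurable (fun x => ENNReal.ofReal (w x)) volume :=
    hw.1.aestronglyMeasurable.aemeasurable.ennreal_ofReal
  set f := hmeas.mk _ with hf
  have hwf : (fun x => ENNReal.ofReal (w x)) =ᵐ[volume] f := hmeas.ae_eq_mk
  have hint : ∀ Q : Set (Fin n → ℝ), ∫⁻ x in Q, f x = wMeas w Q := fun Q =>
    (lintegral_congr_ae (ae_restrict_of_ae hwf)).symm
  have hpos : ∀ᵐ x, 0 < f x := by
    filter_upwards [hwf, hw.2] with x hx hx'
    rw [← hx]
    exact ENNReal.ofReal_pos.2 hx'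
  refine iSup₂_le fun Q hQ => ?_
  obtain ⟨a, h, hh, rfl⟩ := hQ.exists_eq_closedCube
  have hwf' : (fun x => ENNReal.ofReal (w x) ^ (-(1 / (p - 1)))) =ᵐ[volume]
      fun x => f x ^ (-(1 / (p - 1))) := hwf.fun_comp fun y => y ^ (-(1 / (p - 1)))
  rw [cubeAvg_congr_ae hwf, cubeAvg_congr_ae hwf']
  refine (cubeAvg_mul_rpow_cubeAvg_le hmeas.measurable_mk hpos
    (fun a h => hint _ ▸ hw.wMeas_closedCube_ne_top a h)
    (fun a h hh => hint _ ▸ hw.wMeas_closedCube_ne_zero a hh) hA0 (fun a h hh => ?_) hθ hN0 hNθ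
    hpN a hh).trans (ENNReal.ofReal_le_ofReal hbound)
  rw [hint, ← hlM_congr_ae (hwf.indicator (s := closedCube a h))]
  exact (lintegral_hlM_le_aInfConst_mul hw a hh).trans (by gcongr)
end

section
/- Let v ∈ A_∞ and u ∈ A₁ be weights on ℝⁿ. Then there is a dimensional constant c_n such that for every f ∈ L¹(uv): ‖M(fv)/v‖_{L^{1,∞}(uv)} ≤ c_n [u]_{A₁} [v]_{A_∞} ( [u]_{A₁}[v]_{A_∞} + [u]_{A_∞} e^{c_n [v]_{A_∞}} ) ‖f‖_{L¹(uv)}. -/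
open MeasureTheory ENNReal NNReal

noncomputable section

namespace MixedWeak

open Set Filter Topology

variable {n : ℕ}

/-- The half-open cube with lower corner `a` and side length `h`. -/
def hbox (a : Fin n → ℝ) (h : ℝ) : Set (Fin n → ℝ) :=
  Set.pi univ fun i => Ico (a i) (a i + h)

/-- The closed cube with lower corner `a` and side length `h`. -/
def cbox (a : Fin n → ℝ) (h : ℝ) : Set (Fin n → ℝ) :=
  Icc a fun i => a i + h

lemma mem_hbox {a : Fin n → ℝ} {h : ℝ} {x : Fin n → ℝ} :
    x ∈ hbox a h ↔ ∀ i, a i ≤ x i ∧ x i < a i + h := by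
  simp [hbox]

lemma mem_cbox {a : Fin n → ℝ} {h : ℝ} {x : Fin n → ℝ} :
    x ∈ cbox a h ↔ ∀ i, a i ≤ x i ∧ x i ≤ a i + h := by
  simp [cbox, Pi.le_def, forall_and]

lemma isCube_cbox (a : Fin n → ℝ) {h : ℝ} (hh : 0 < h) : IsCube (cbox a h) :=
  ⟨a, h, hh, by ext x; exact mem_cbox⟩

lemma measurableSet_hbox (a : Fin n → ℝ) (h : ℝ) : MeasurableSet (hbox a h) :=
  MeasurableSet.univ_pi fun _ => measurableSet_Ico

lemma measurableSet_cbox (a : Fin n → ℝ) (h : ℝ) : MeasurableSet (cbox a h) :=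
  measurableSet_Icc

lemma hbox_ae_eq_cbox (a : Fin n → ℝ) (h : ℝ) : hbox a h =ᵐ[volume] cbox a h :=
  Measure.univ_pi_Ico_ae_eq_Icc

lemma hbox_subset_cbox (a : Fin n → ℝ) (h : ℝ) : hbox a h ⊆ cbox a h := fun _ hx =>
  mem_cbox.2 fun i => ⟨(mem_hbox.1 hx i).1, (mem_hbox.1 hx i).2.le⟩

lemma volume_hbox (a : Fin n → ℝ) (h : ℝ) : volume (hbox a h) = ENNReal.ofReal h ^ n := by
  simp [hbox, Real.volume_pi_Ico]

lemma volume_hbox_pos (a : Fin n → ℝ) {h : ℝ} (hh : 0 < h) : volume (hbox a h) ≠ 0 := by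
  rw [volume_hbox]
  exact pow_ne_zero _ (by simpa using hh)

lemma volume_hbox_ne_top (a : Fin n → ℝ) (h : ℝ) : volume (hbox a h) ≠ ∞ := by
  rw [volume_hbox]
  exact ENNReal.pow_ne_top ENNReal.ofReal_ne_top

/-- Half-open averages are dominated by the maximal operator. -/
lemma cubeAvg_hbox_le_hlM (f : (Fin n → ℝ) → ℝ≥0∞) {a : Fin n → ℝ} {h : ℝ} (hh : 0 < h)
    {x : Fin n → ℝ} (hx : x ∈ hbox a h) : cubeAvg f (hbox a h) ≤ hlM f x := by
  have : cubeAvg f (hbox a h) = cubeAvg f (cbox a h) := by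
    unfold cubeAvg
    rw [setLIntegral_congr (hbox_ae_eq_cbox a h), measure_congr (hbox_ae_eq_cbox a h)]
  rw [this]
  exact le_iSup_of_le _ (le_iSup_of_le (isCube_cbox a hh)
    (le_iSup_of_le (hbox_subset_cbox a h hx) le_rfl))

/-- A dyadic grid of half-open cubes of side lengths `h, h/2, h/4, …`, with a vertex at `a`. -/
structure Grid (n : ℕ) where
  /-- a vertex of the grid -/
  a : Fin n → ℝ
  /-- the largest side length -/
  h : ℝ
  pos : 0 < h

namespace Grid

variable (D : Grid n)

/-- The label of the cell of generation `k` containing `x`. -/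
def idx (k : ℕ) (x : Fin n → ℝ) : Fin n → ℤ := fun i => ⌊2 ^ k * ((x i - D.a i) / D.h)⌋

/-- Side length of the cells of generation `k`. -/
def side (k : ℕ) : ℝ := D.h / 2 ^ k

/-- Lower corner of a cell. -/
def corner (k : ℕ) (m : Fin n → ℤ) : Fin n → ℝ := fun i => D.a i + D.side k * m i

/-- The cell of generation `k` with label `m`. -/
def cellAt (k : ℕ) (m : Fin n → ℤ) : Set (Fin n → ℝ) := hbox (D.corner k m) (D.side k)

/-- The cell of generation `k` containing `x`. -/
def cell (k : ℕ) (x : Fin n → ℝ) : Set (Fin n → ℝ) := D.cellAt k (D.idx k x)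

lemma side_pos (k : ℕ) : 0 < D.side k := div_pos D.pos (by positivity)

lemma mem_cellAt {k : ℕ} {m : Fin n → ℤ} {x : Fin n → ℝ} :
    x ∈ D.cellAt k m ↔ D.idx k x = m := by
  have hs := D.side_pos k
  have hd := D.pos
  simp only [cellAt, mem_hbox, corner, idx, funext_iff, Int.floor_eq_iff]
  refine forall_congr' fun i => ?_
  have e : 2 ^ k * ((x i - D.a i) / D.h) = (x i - D.a i) / D.side k := by
    simp only [side]; field_simp
  rw [e, le_div_iff₀ hs, div_lt_iff₀ hs]
  constructor <;> rintro ⟨h1, h2⟩ <;> constructor <;> linarith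

lemma mem_cell {k : ℕ} {x y : Fin n → ℝ} : y ∈ D.cell k x ↔ D.idx k y = D.idx k x :=
  D.mem_cellAt

lemma mem_cell_self (k : ℕ) (x : Fin n → ℝ) : x ∈ D.cell k x := D.mem_cell.2 rfl

lemma cell_eq {k : ℕ} {x y : Fin n → ℝ} (h : y ∈ D.cell k x) : D.cell k y = D.cell k x := by
  unfold cell
  rw [D.mem_cell.1 h]

lemma idx_succ (k : ℕ) (x : Fin n → ℝ) (i : Fin n) : D.idx k x i = D.idx (k + 1) x i / 2 := by
  unfold idx
  have := Int.floor_div_natCast (2 ^ (k + 1) * ((x i - D.a i) / D.h)) 2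
  simp only [Nat.cast_ofNat] at this
  rw [← this]
  congr 1
  ring

lemma idx_eq_of_le {j k : ℕ} (hjk : j ≤ k) {x y : Fin n → ℝ} (h : D.idx k y = D.idx k x) :
    D.idx j y = D.idx j x := by
  induction k, hjk using Nat.le_induction with
  | base => exact h
  | succ k _ ih =>
    apply ih
    funext i
    rw [D.idx_succ k y, D.idx_succ k x, h]

lemma cell_subset {j k : ℕ} (hjk : j ≤ k) (x : Fin n → ℝ) : D.cell k x ⊆ D.cell j x :=
  fun _ hy => D.mem_cell.2 (D.idx_eq_of_le hjk (D.mem_cell.1 hy))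

lemma mem_cell_comm {k : ℕ} {x y : Fin n → ℝ} : y ∈ D.cell k x ↔ x ∈ D.cell k y := by
  rw [mem_cell, mem_cell, eq_comm]

lemma measurableSet_cell (k : ℕ) (x : Fin n → ℝ) : MeasurableSet (D.cell k x) :=
  measurableSet_hbox _ _

lemma measurable_idx (k : ℕ) : Measurable (D.idx k) := by
  refine measurable_pi_lambda _ fun i => ?_
  exact Int.measurable_floor.comp (by fun_prop)

lemma volume_cell (k : ℕ) (x : Fin n → ℝ) :
    volume (D.cell k x) = ENNReal.ofReal (D.side k) ^ n := volume_hbox _ _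

lemma volume_cell_ne_zero (k : ℕ) (x : Fin n → ℝ) : volume (D.cell k x) ≠ 0 :=
  volume_hbox_pos _ (D.side_pos k)

lemma volume_cell_ne_top (k : ℕ) (x : Fin n → ℝ) : volume (D.cell k x) ≠ ∞ :=
  volume_hbox_ne_top _ _

lemma volume_cell_succ (k : ℕ) (x : Fin n → ℝ) :
    volume (D.cell k x) = 2 ^ n * volume (D.cell (k + 1) x) := by
  rw [volume_cell, volume_cell, ← mul_pow]
  congr 1
  have : D.side k = 2 * D.side (k + 1) := by
    simp only [side]; field_simp; ring
  rw [this, ENNReal.ofReal_mul (by norm_num)]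
  simp

/-- The average of `w` over the cell of generation `k` containing `x`. -/
def avg (w : (Fin n → ℝ) → ℝ≥0∞) (k : ℕ) (x : Fin n → ℝ) : ℝ≥0∞ := cubeAvg w (D.cell k x)

variable {D} in
lemma avg_eq {w : (Fin n → ℝ) → ℝ≥0∞} {k : ℕ} {x y : Fin n → ℝ} (h : y ∈ D.cell k x) :
    D.avg w k y = D.avg w k x := by
  unfold avg
  rw [D.cell_eq h]

lemma cell_zero {x : Fin n → ℝ} (hx : x ∈ hbox D.a D.h) : D.cell 0 x = hbox D.a D.h := by
  have : D.cellAt 0 0 = hbox D.a D.h := by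
    simp [cellAt, side]
    congr 1
    funext i
    simp [corner]
  rw [← this]
  unfold cell
  rw [D.mem_cellAt.1 (this ▸ hx : x ∈ D.cellAt 0 0)]

lemma lintegral_cell (w : (Fin n → ℝ) → ℝ≥0∞) (k : ℕ) (x : Fin n → ℝ) :
    ∫⁻ y in D.cell k x, w y = D.avg w k x * volume (D.cell k x) := by
  unfold avg cubeAvg
  rw [ENNReal.div_mul_cancel (D.volume_cell_ne_zero k x) (D.volume_cell_ne_top k x)]

lemma measurable_avg (w : (Fin n → ℝ) → ℝ≥0∞) (k : ℕ) : Measurable (D.avg w k) :=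
  (measurable_of_countable fun m => cubeAvg w (D.cellAt k m)).comp (D.measurable_idx k)

lemma avg_succ_le (w : (Fin n → ℝ) → ℝ≥0∞) (k : ℕ) (x : Fin n → ℝ) :
    D.avg w (k + 1) x ≤ 2 ^ n * D.avg w k x := by
  have h0 := D.volume_cell_ne_zero (k + 1) x
  have h1 := D.volume_cell_ne_top (k + 1) x
  have : ∫⁻ y in D.cell (k + 1) x, w y ≤ ∫⁻ y in D.cell k x, w y :=
    lintegral_mono_set (D.cell_subset k.le_succ x)
  rw [lintegral_cell, lintegral_cell, D.volume_cell_succ k, ← mul_assoc] at this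
  rw [mul_comm (2 ^ n : ℝ≥0∞)]
  exact (ENNReal.mul_le_mul_iff_left h0 h1).1 this

/-- The set where a stopping condition is met in some generation. -/
def hit (P : ℕ → (Fin n → ℝ) → Prop) : Set (Fin n → ℝ) := {x | ∃ k, P k x}

/-- A condition on the cells of the grid. -/
def Adapted (P : ℕ → (Fin n → ℝ) → Prop) : Prop :=
  ∀ k x y, y ∈ D.cell k x → P k x → P k y

variable {D}

lemma Adapted.measurableSet {P : ℕ → (Fin n → ℝ) → Prop} (hP : D.Adapted P) (k : ℕ) :
    MeasurableSet {x | P k x} := by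
  have : {x | P k x} = D.idx k ⁻¹' (D.idx k '' {x | P k x}) := by
    refine (subset_preimage_image _ _).antisymm ?_
    rintro y ⟨x, hx, hxy⟩
    exact hP k x y (D.mem_cell.2 hxy.symm) hx
  rw [this]
  exact D.measurable_idx k (Set.to_countable _).measurableSet

lemma Adapted.measurableSet_hit {P : ℕ → (Fin n → ℝ) → Prop} (hP : D.Adapted P) :
    MeasurableSet (hit P) := by
  have : hit P = ⋃ k, {x | P k x} := by ext; simp [hit]
  rw [this]
  exact MeasurableSet.iUnion hP.measurableSet

/-- An inequality between integrals over all stopping cells sums up. -/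
lemma Adapted.lintegral_hit_le {P : ℕ → (Fin n → ℝ) → Prop} (hP : D.Adapted P)
    {F H : (Fin n → ℝ) → ℝ≥0∞}
    (h : ∀ k x, P k x → (∀ j < k, ¬ P j x) →
      ∫⁻ y in D.cell k x, F y ≤ ∫⁻ y in D.cell k x, H y) :
    ∫⁻ y in hit P, F y ≤ ∫⁻ y in hit P, H y := by
  classical
  let P' : ℕ → (Fin n → ℝ) → Prop := fun k x => P k x ∧ ∀ j < k, ¬ P j x
  have hP' : D.Adapted P' := by
    rintro k x y hy ⟨h1, h2⟩
    refine ⟨hP k x y hy h1, fun j hj hPj => h2 j hj (hP j y x ?_ hPj)⟩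
    exact D.mem_cell_comm.1 (D.cell_subset hj.le x hy)
  let s : ℕ × (Fin n → ℤ) → Set (Fin n → ℝ) := fun p => {x | P' p.1 x ∧ D.idx p.1 x = p.2}
  have hs : hit P = ⋃ p, s p := by
    ext x
    simp only [hit, mem_ofPred_eq, mem_iUnion, s, P']
    constructor
    · intro hx
      exact ⟨(Nat.find hx, D.idx _ x), ⟨Nat.find_spec hx, fun j hj => Nat.find_min hx hj⟩, rfl⟩
    · rintro ⟨p, ⟨hp, -⟩, -⟩
      exact ⟨_, hp⟩
  have hsm : ∀ p, MeasurableSet (s p) := fun p =>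
    (hP'.measurableSet p.1).inter (D.measurable_idx p.1 (measurableSet_singleton p.2))
  have hsd : Pairwise (Function.onFun Disjoint s) := by
    intro p q hpq
    rw [Function.onFun, Set.disjoint_left]
    rintro x ⟨⟨h1, h2⟩, h3⟩ ⟨⟨h1', h2'⟩, h3'⟩
    apply hpq
    rcases lt_trichotomy p.1 q.1 with hlt | heq | hlt
    · exact absurd h1 (h2' _ hlt)
    · refine Prod.ext heq ?_
      rw [← h3, ← h3', heq]
    · exact absurd h1' (h2 _ hlt)
  rw [hs, lintegral_iUnion hsm hsd, lintegral_iUnion hsm hsd]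
  refine ENNReal.tsum_le_tsum fun p => ?_
  rcases (s p).eq_empty_or_nonempty with he | ⟨x, hx⟩
  · simp [he]
  · have : s p = D.cell p.1 x := by
      ext y
      rw [mem_cell, hx.2]
      exact ⟨fun hy => hy.2, fun hy => ⟨hP' p.1 x y (D.mem_cell.2 (hy.trans hx.2.symm)) hx.1, hy⟩⟩
    rw [this]
    exact h _ _ hx.1.1 hx.1.2

/-- Lebesgue differentiation along the grid. -/
lemma ae_tendsto_avg (D : Grid n) {w : (Fin n → ℝ) → ℝ≥0∞} (hw : Measurable w)
    (hfin : ∀ (a : Fin n → ℝ) (h : ℝ), ∫⁻ y in hbox a h, w y ≠ ∞) :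
    ∀ᵐ x, x ∈ hbox D.a D.h → Tendsto (fun k => D.avg w k x) atTop (𝓝 (w x)) := by
  have hQ := measurableSet_hbox D.a D.h
  have hf : ∫⁻ y, (hbox D.a D.h).indicator w y ≠ ∞ := by
    rw [lintegral_indicator hQ]
    exact hfin _ _
  filter_upwards [(IsUnifLocDoublingMeasure.vitaliFamily
    (volume : Measure (Fin n → ℝ)) 1).ae_tendsto_lintegral_div (hw.indicator hQ).aemeasurable hf] with x hx hxQ
  have hc0 := D.cell_zero hxQ
  have hlim : Tendsto (fun k => D.side k / 2) atTop (𝓝[>] 0) := by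
    refine tendsto_nhdsWithin_iff.2 ⟨?_, Eventually.of_forall fun k => half_pos (D.side_pos k)⟩
    have : Tendsto (fun k : ℕ => D.h / 2 * (1 / 2 : ℝ) ^ k) atTop (𝓝 (D.h / 2 * 0)) :=
      (_root_.tendsto_pow_atTop_nhds_zero_of_lt_one (by norm_num) (by norm_num)).const_mul _
    rw [mul_zero] at this
    refine this.congr fun k => ?_
    simp only [side, one_div, inv_pow]
    field_simp
  let c : ℕ → Fin n → ℝ := fun k i => D.corner k (D.idx k x) i + D.side k / 2
  have hball : ∀ k, Metric.closedBall (c k) (D.side k / 2) =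
      cbox (D.corner k (D.idx k x)) (D.side k) := by
    intro k
    ext y
    rw [mem_cbox, Metric.mem_closedBall, dist_pi_le_iff (half_pos (D.side_pos k)).le]
    refine forall_congr' fun i => ?_
    rw [Real.dist_eq, abs_le]
    simp only [c]
    constructor <;> rintro ⟨h1, h2⟩ <;> constructor <;> linarith
  have hmem : ∀ᶠ k in atTop, x ∈ Metric.closedBall (c k) (1 * (D.side k / 2)) :=
    Eventually.of_forall fun k => by
      rw [one_mul, hball]
      exact hbox_subset_cbox _ _ (D.mem_cell_self k x)
  have := hx.comp (IsUnifLocDoublingMeasure.tendsto_closedBall_filterAt volume c _ hlim hmem)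
  rw [indicator_of_mem hxQ] at this
  refine this.congr fun k => ?_
  simp only [Function.comp_apply, hball, avg, cubeAvg]
  have hae : D.cell k x =ᵐ[volume] cbox (D.corner k (D.idx k x)) (D.side k) :=
    hbox_ae_eq_cbox _ _
  rw [← setLIntegral_congr hae, ← measure_congr hae]
  congr 1
  refine setLIntegral_congr_fun (D.measurableSet_cell k x) fun y hy => ?_
  rw [indicator_of_mem]
  rw [← hc0]
  exact D.cell_subset k.zero_le x hy

end Grid

lemma sum_two_pow_mul_le (N : ℕ) (c s : ℝ≥0∞) :
    ∑ r ∈ Finset.range N, (if 2 ^ r * c ≤ s then 2 ^ r * c else 0) ≤ 2 * s := by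
  have hfull : ∀ N : ℕ, ∑ r ∈ Finset.range N, (2 : ℝ≥0∞) ^ r * c ≤ 2 ^ N * c := by
    intro N
    induction N with
    | zero => simp
    | succ N ih =>
      rw [Finset.sum_range_succ, pow_succ, mul_two, add_mul]
      gcongr
  induction N with
  | zero => simp
  | succ N ih =>
    by_cases h : 2 ^ N * c ≤ s
    · calc ∑ r ∈ Finset.range (N + 1), (if 2 ^ r * c ≤ s then 2 ^ r * c else 0)
          ≤ ∑ r ∈ Finset.range (N + 1), 2 ^ r * c := by
            refine Finset.sum_le_sum fun r _ => ?_
            split_ifs <;> simp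
        _ ≤ 2 ^ (N + 1) * c := hfull _
        _ = 2 * (2 ^ N * c) := by ring
        _ ≤ 2 * s := by gcongr
    · rw [Finset.sum_range_succ, if_neg h, add_zero]
      exact ih

lemma tsum_two_zpow_le (s : ℝ≥0∞) :
    ∑' i : ℤ, (if (2 : ℝ≥0∞) ^ i ≤ s then (2 : ℝ≥0∞) ^ i else 0) ≤ 2 * s := by
  classical
  rw [ENNReal.tsum_eq_iSup_sum]
  refine iSup_le fun F => ?_
  obtain ⟨M, hM⟩ : ∃ M : ℕ, ∀ i ∈ F, i.natAbs ≤ M :=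
    ⟨F.sup Int.natAbs, fun i hi => Finset.le_sup (f := Int.natAbs) hi⟩
  let e : ℕ ↪ ℤ := ⟨fun r => (r : ℤ) - M, fun r r' h => by simpa using h⟩
  have hsub : F ⊆ (Finset.range (2 * M + 1)).map e := by
    intro i hi
    have := hM i hi
    refine Finset.mem_map.2 ⟨(i + M).toNat, Finset.mem_range.2 (by omega), ?_⟩
    change ((i + M).toNat : ℤ) - M = i
    omega
  refine (Finset.sum_le_sum_of_subset hsub).trans ?_
  rw [Finset.sum_map]
  refine le_trans (le_of_eq ?_) (sum_two_pow_mul_le (2 * M + 1) ((2 : ℝ≥0∞) ^ (-(M : ℤ))) s)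
  refine Finset.sum_congr rfl fun r _ => ?_
  have : (2 : ℝ≥0∞) ^ (e r) = 2 ^ r * (2 : ℝ≥0∞) ^ (-(M : ℤ)) := by
    simp only [e, Function.Embedding.coeFn_mk, sub_eq_add_neg]
    rw [ENNReal.zpow_add (by norm_num) (by norm_num), zpow_natCast]
  rw [this]

/-- `w` is a positive measurable weight, finite on cubes, whose Fujii–Wilson constant
is at most `K`. -/
structure AInfBound (w : (Fin n → ℝ) → ℝ≥0∞) (K : ℝ≥0∞) : Prop where
  meas : Measurable w
  pos : ∀ x, w x ≠ 0
  fin : ∀ (a : Fin n → ℝ) (h : ℝ), ∫⁻ y in hbox a h, w y ≠ ∞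
  bound : ∀ (a : Fin n → ℝ) (h : ℝ), 0 < h →
    ∫⁻ y in hbox a h, hlM ((hbox a h).indicator w) y ≤ K * ∫⁻ y in hbox a h, w y

namespace AInfBound

variable {w : (Fin n → ℝ) → ℝ≥0∞} {K : ℝ≥0∞}

lemma lintegral_hbox_ne_zero (hw : AInfBound w K) (a : Fin n → ℝ) {h : ℝ} (hh : 0 < h) :
    ∫⁻ y in hbox a h, w y ≠ 0 := by
  intro h0
  rw [lintegral_eq_zero_iff hw.meas] at h0
  have : volume (hbox a h) = 0 := by
    rw [← Measure.restrict_eq_zero, ← ae_eq_bot]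
    by_contra hne
    have : (ae (volume.restrict (hbox a h))).NeBot := ⟨hne⟩
    obtain ⟨x, hx⟩ := h0.exists
    exact hw.pos x hx
  exact volume_hbox_pos a hh this

lemma avg_ne_zero (hw : AInfBound w K) (D : Grid n) (k : ℕ) (x : Fin n → ℝ) :
    D.avg w k x ≠ 0 :=
  ENNReal.div_ne_zero.2 ⟨hw.lintegral_hbox_ne_zero _ (D.side_pos k), D.volume_cell_ne_top k x⟩

lemma avg_ne_top (hw : AInfBound w K) (D : Grid n) (k : ℕ) (x : Fin n → ℝ) :
    D.avg w k x ≠ ∞ :=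
  ENNReal.div_ne_top (hw.fin _ _) (D.volume_cell_ne_zero k x)

/-- The bound for the dyadic maximal function localized to a cell. -/
lemma lintegral_iSup_avg_le (hw : AInfBound w K) (D : Grid n) (j : ℕ) (x : Fin n → ℝ) :
    ∫⁻ y in D.cell j x, ⨆ (k) (_ : j ≤ k), D.avg w k y ≤ K * ∫⁻ y in D.cell j x, w y := by
  refine le_trans ?_ (hw.bound _ _ (D.side_pos j))
  refine setLIntegral_mono' (D.measurableSet_cell j x) fun y hy => iSup₂_le fun k hk => ?_
  refine le_trans (le_of_eq ?_)
    (cubeAvg_hbox_le_hlM ((D.cell j x).indicator w) (D.side_pos k) (D.mem_cell_self k y))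
  unfold Grid.avg cubeAvg
  congr 1
  refine setLIntegral_congr_fun (D.measurableSet_cell k y) fun z hz => ?_
  rw [indicator_of_mem]
  rw [← D.cell_eq hy]
  exact D.cell_subset hk y hz

end AInfBound

lemma Grid.lintegral_level_le (D : Grid n) (w : (Fin n → ℝ) → ℝ≥0∞) (k : ℕ) (x : Fin n → ℝ)
    (t : ℝ≥0∞) (h0 : D.avg w 0 x ≤ 2 ^ n * t) (hlt : ∀ j < k, D.avg w j x < t) :
    ∫⁻ y in D.cell k x ∩ {y | ∃ j, t ≤ D.avg w j y}, w y ≤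
      2 ^ n * t * volume (D.cell k x ∩ {y | ∃ j, t ≤ D.avg w j y}) := by
  let P : ℕ → (Fin n → ℝ) → Prop := fun j y => k ≤ j ∧ y ∈ D.cell k x ∧ t ≤ D.avg w j y
  have hlt' : ∀ y ∈ D.cell k x, ∀ j < k, D.avg w j y < t := fun y hy j hj => by
    rw [Grid.avg_eq (D.cell_subset hj.le x hy)]
    exact hlt j hj
  have hP : D.Adapted P := by
    rintro j y z hz ⟨h1, h2, h3⟩
    refine ⟨h1, ?_, by rwa [Grid.avg_eq hz]⟩
    rw [← D.cell_eq h2]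
    exact D.cell_subset h1 y hz
  have hhit : D.cell k x ∩ {y | ∃ j, t ≤ D.avg w j y} = Grid.hit P := by
    ext y
    constructor
    · rintro ⟨hy, j, hj⟩
      refine ⟨j, ?_, hy, hj⟩
      by_contra hjk
      exact absurd hj (not_le.2 (hlt' y hy j (not_le.1 hjk)))
    · rintro ⟨j, -, hy, hj⟩
      exact ⟨hy, j, hj⟩
  rw [hhit, ← setLIntegral_const]
  refine hP.lintegral_hit_le fun j y hy hfirst => ?_
  rw [setLIntegral_const, D.lintegral_cell]
  gcongr
  obtain ⟨hkj, hyJ, -⟩ := hy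
  cases j with
  | zero =>
    have : k = 0 := by omega
    subst this
    rwa [Grid.avg_eq hyJ]
  | succ j =>
    refine (D.avg_succ_le w j y).trans ?_
    gcongr
    by_cases hj : k ≤ j
    · by_contra hcon
      exact hfirst j j.lt_succ_self ⟨hj, hyJ, (not_le.1 hcon).le⟩
    · exact (hlt' y hyJ j (not_le.1 hj)).le

namespace AInfBound

variable {w : (Fin n → ℝ) → ℝ≥0∞} {K : ℝ≥0∞}

/-- The part of the top cell of `D` where the dyadic maximal function of `w` is large. -/
def bigSet (w : (Fin n → ℝ) → ℝ≥0∞) (D : Grid n) (i : ℕ) : ℕ → (Fin n → ℝ) → Prop :=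
  fun k x => x ∈ hbox D.a D.h ∧ 2 ^ i * cubeAvg w (hbox D.a D.h) ≤ D.avg w k x

lemma adapted_bigSet (w : (Fin n → ℝ) → ℝ≥0∞) (D : Grid n) (i : ℕ) :
    D.Adapted (bigSet w D i) := by
  rintro k x y hy ⟨h1, h2⟩
  refine ⟨?_, by rwa [Grid.avg_eq hy]⟩
  rw [← D.cell_zero h1]
  exact D.cell_subset k.zero_le x hy

lemma lintegral_bigSet_add_le (hw : AInfBound w K) (D : Grid n) {N : ℕ} (hN0 : N ≠ 0)
    (hN : 2 ^ (n + 2) * K ≤ N) (i : ℕ) :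
    ∫⁻ y in Grid.hit (bigSet w D (i + N)), w y ≤ 2⁻¹ * ∫⁻ y in Grid.hit (bigSet w D i), w y := by
  set c := cubeAvg w (hbox D.a D.h) with hc
  have hmono : ∀ r, Grid.hit (bigSet w D (i + r)) ⊆ Grid.hit (bigSet w D i) := by
    rintro r x ⟨k, hk1, hk2⟩
    refine ⟨k, hk1, le_trans ?_ hk2⟩
    gcongr <;> simp
  have hmeas := (adapted_bigSet w D (i + N)).measurableSet_hit
  have key := (adapted_bigSet w D i).lintegral_hit_le
    (F := (Grid.hit (bigSet w D (i + N))).indicator w) (H := fun y => 2⁻¹ * w y) ?_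
  · rw [lintegral_const_mul _ hw.meas, setLIntegral_indicator hmeas,
      inter_eq_left.2 (hmono N)] at key
    exact key
  rintro k x ⟨hxQ, hx⟩ hfirst
  rw [lintegral_const_mul _ hw.meas, setLIntegral_indicator hmeas]
  have hlt : ∀ j < k, D.avg w j x < 2 ^ i * c := fun j hj => by
    by_contra hcon
    exact hfirst j hj ⟨hxQ, not_lt.1 hcon⟩
  have hle : ∀ r : ℕ, 2 ^ i * c ≤ 2 ^ (i + r) * c := fun r => by
    gcongr <;> simp
  let L : ℕ → Set (Fin n → ℝ) := fun r => {y | ∃ j, 2 ^ (i + r) * c ≤ D.avg w j y}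
  have hLm : ∀ r, MeasurableSet (L r) := fun r => by
    have : L r = ⋃ j, {y | 2 ^ (i + r) * c ≤ D.avg w j y} := by ext; simp [L]
    rw [this]
    exact MeasurableSet.iUnion fun j => measurableSet_le measurable_const (D.measurable_avg w j)
  have hr : ∀ r ∈ Finset.range N,
      ∫⁻ y in Grid.hit (bigSet w D (i + N)) ∩ D.cell k x, w y ≤
        2 ^ n * ∫⁻ y in D.cell k x,
          (L r).indicator (fun _ => 2 ^ (i + r) * c) y := by
    intro r hr
    have hsub : Grid.hit (bigSet w D (i + N)) ∩ D.cell k x ⊆ D.cell k x ∩ L r := by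
      rintro y ⟨⟨j, -, hj⟩, hy⟩
      refine ⟨hy, j, le_trans ?_ hj⟩
      gcongr
      · simp
      · exact (Finset.mem_range.1 hr).le
    refine (lintegral_mono_set hsub).trans ?_
    refine (D.lintegral_level_le w k x (2 ^ (i + r) * c) ?_ fun j hj =>
      (hlt j hj).trans_le (hle r)).trans (le_of_eq ?_)
    · have : D.avg w 0 x = c := by rw [hc, ← D.cell_zero hxQ]; rfl
      rw [this, ← mul_assoc, ← pow_add]
      exact le_mul_of_one_le_left zero_le (one_le_pow₀ (by norm_num))
    · rw [setLIntegral_indicator (hLm r), setLIntegral_const, inter_comm, mul_assoc]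
  have hsum := Finset.sum_le_sum hr
  rw [Finset.sum_const, Finset.card_range, nsmul_eq_mul, ← Finset.mul_sum,
    ← lintegral_finsetSum _ fun r _ => measurable_const.indicator (hLm r)] at hsum
  have hpt : ∫⁻ y in D.cell k x, ∑ r ∈ Finset.range N,
        (L r).indicator (fun _ => 2 ^ (i + r) * c) y ≤
      2 * (K * ∫⁻ y in D.cell k x, w y) := by
    refine le_trans ?_ (mul_le_mul_right (hw.lintegral_iSup_avg_le D k x) 2)
    rw [← lintegral_const_mul' _ _ (by norm_num)]
    refine setLIntegral_mono' (D.measurableSet_cell k x) fun y hy => ?_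
    refine le_trans (Finset.sum_le_sum fun r _ => ?_)
      (sum_two_pow_mul_le N (2 ^ i * c) (⨆ (j) (_ : k ≤ j), D.avg w j y))
    by_cases hyL : y ∈ L r
    · obtain ⟨j, hj⟩ := hyL
      have hkj : k ≤ j := by
        by_contra hcon
        rw [Grid.avg_eq (D.cell_subset (not_le.1 hcon).le x hy)] at hj
        exact absurd ((hle r).trans hj) (not_le.2 (hlt j (not_le.1 hcon)))
      have e : 2 ^ r * (2 ^ i * c) = 2 ^ (i + r) * c := by ring
      rw [indicator_of_mem (show y ∈ L r from ⟨j, hj⟩), e, if_pos]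
      exact hj.trans (le_iSup₂_of_le j hkj le_rfl)
    · simp [hyL]
  have hN0' : (N : ℝ≥0∞) ≠ 0 := by exact_mod_cast hN0
  have hfin : (N : ℝ≥0∞) * ∫⁻ y in Grid.hit (bigSet w D (i + N)) ∩ D.cell k x, w y ≤
      N * (2⁻¹ * ∫⁻ y in D.cell k x, w y) := by
    refine hsum.trans ((mul_le_mul_right hpt _).trans ?_)
    calc (2 : ℝ≥0∞) ^ n * (2 * (K * ∫⁻ y in D.cell k x, w y))
        = (2 ^ (n + 2) * K) * (2⁻¹ * ∫⁻ y in D.cell k x, w y) := by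
          have : (2 : ℝ≥0∞) ^ (n + 2) = 2 ^ n * 2 * 2 := by ring
          rw [this]
          have h2 : (2 : ℝ≥0∞) * 2⁻¹ = 1 := ENNReal.mul_inv_cancel (by norm_num) (by norm_num)
          calc _ = (2 : ℝ≥0∞) ^ n * (2 * (K * ∫⁻ y in D.cell k x, w y)) * 1 := by ring
            _ = _ := by rw [← h2]; ring
      _ ≤ _ := by gcongr
  exact (ENNReal.mul_le_mul_iff_right hN0' (ENNReal.natCast_ne_top N)).1 hfin

/-- Quantitative absolute continuity of an `A_∞` weight. -/
lemma lintegral_inter_le (hw : AInfBound w K) {N : ℕ} (hN0 : N ≠ 0)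
    (hN : 2 ^ (n + 2) * K ≤ N) (a : Fin n → ℝ) {h : ℝ} (hh : 0 < h)
    {E : Set (Fin n → ℝ)} (hE : MeasurableSet E) (q : ℕ) :
    ∫⁻ y in hbox a h ∩ E, w y ≤ 2⁻¹ ^ q * (∫⁻ y in hbox a h, w y) +
      2 ^ (q * N) * cubeAvg w (hbox a h) * volume (hbox a h ∩ E) := by
  let D : Grid n := ⟨a, h, hh⟩
  have hdecay : ∀ q : ℕ, ∫⁻ y in Grid.hit (bigSet w D (q * N)), w y ≤
      2⁻¹ ^ q * ∫⁻ y in hbox a h, w y := by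
    intro q
    induction q with
    | zero =>
      rw [pow_zero, one_mul]
      exact lintegral_mono_set fun x ⟨k, hk, _⟩ => hk
    | succ q ih =>
      rw [Nat.succ_mul, pow_succ', mul_assoc]
      exact (hw.lintegral_bigSet_add_le D hN0 hN _).trans (mul_le_mul_right ih _)
  set Ω := Grid.hit (bigSet w D (q * N))
  have hΩ : MeasurableSet Ω := (adapted_bigSet w D _).measurableSet_hit
  have hQE := (measurableSet_hbox a h).inter hE
  have h1 : ∫⁻ y in hbox a h ∩ E ∩ Ω, w y ≤ 2⁻¹ ^ q * ∫⁻ y in hbox a h, w y :=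
    (lintegral_mono_set inter_subset_right).trans (hdecay q)
  rw [← lintegral_inter_add_sdiff w (hbox a h ∩ E) hΩ]
  refine add_le_add h1 ?_
  rw [← setLIntegral_const]
  refine le_trans ?_ (lintegral_mono_set (s := (hbox a h ∩ E) \ Ω) sdiff_subset)
  refine setLIntegral_mono_ae' (hQE.diff hΩ) ?_
  filter_upwards [D.ae_tendsto_avg hw.meas hw.fin] with x hx hx'
  refine le_of_tendsto (hx hx'.1.1) (Eventually.of_forall fun k => ?_)
  by_contra hcon
  exact hx'.2 ⟨k, hx'.1.1, (not_le.1 hcon).le⟩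

end AInfBound

/-- Sets of relative measure at most `2⁻ᵐ` in a cube carry at most half of its mass. -/
def HalfSmall (w : (Fin n → ℝ) → ℝ≥0∞) (m : ℕ) : Prop :=
  ∀ (a : Fin n → ℝ) (h : ℝ), 0 < h → ∀ E, MeasurableSet E →
    volume (hbox a h ∩ E) ≤ 2⁻¹ ^ m * volume (hbox a h) →
    ∫⁻ y in hbox a h ∩ E, w y ≤ 2⁻¹ * ∫⁻ y in hbox a h, w y

lemma lintegral_hbox_eq (w : (Fin n → ℝ) → ℝ≥0∞) (a : Fin n → ℝ) {h : ℝ} (hh : 0 < h) :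
    cubeAvg w (hbox a h) * volume (hbox a h) = ∫⁻ y in hbox a h, w y := by
  unfold cubeAvg
  rw [ENNReal.div_mul_cancel (volume_hbox_pos a hh) (volume_hbox_ne_top a h)]

lemma inv_two_pow_mul (q : ℕ) : (2⁻¹ : ℝ≥0∞) ^ q * 2 ^ q = 1 := by
  rw [← mul_pow, ENNReal.inv_mul_cancel (by norm_num) (by norm_num), one_pow]

namespace AInfBound

variable {w : (Fin n → ℝ) → ℝ≥0∞} {K : ℝ≥0∞}

lemma lintegral_inter_le_of_volume_le (hw : AInfBound w K) {N : ℕ} (hN0 : N ≠ 0)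
    (hN : 2 ^ (n + 2) * K ≤ N) (a : Fin n → ℝ) {h : ℝ} (hh : 0 < h)
    {E : Set (Fin n → ℝ)} (hE : MeasurableSet E) (q : ℕ)
    (hvol : volume (hbox a h ∩ E) ≤ 2⁻¹ ^ (q * (N + 1)) * volume (hbox a h)) :
    ∫⁻ y in hbox a h ∩ E, w y ≤ 2 * 2⁻¹ ^ q * ∫⁻ y in hbox a h, w y := by
  refine (hw.lintegral_inter_le hN0 hN a hh hE q).trans ?_
  have h1 : 2 ^ (q * N) * cubeAvg w (hbox a h) * volume (hbox a h ∩ E) ≤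
      2⁻¹ ^ q * ∫⁻ y in hbox a h, w y := by
    calc 2 ^ (q * N) * cubeAvg w (hbox a h) * volume (hbox a h ∩ E)
        ≤ 2 ^ (q * N) * cubeAvg w (hbox a h) *
          (2⁻¹ ^ (q * (N + 1)) * volume (hbox a h)) := by gcongr
      _ = (2⁻¹ ^ (q * N) * 2 ^ (q * N)) * (2⁻¹ ^ q *
          (cubeAvg w (hbox a h) * volume (hbox a h))) := by
          rw [mul_add, mul_one, pow_add]; ring
      _ = _ := by rw [inv_two_pow_mul, one_mul, lintegral_hbox_eq w a hh]
  refine (add_le_add le_rfl h1).trans (le_of_eq ?_)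
  ring

lemma halfSmall (hw : AInfBound w K) {N : ℕ} (hN0 : N ≠ 0)
    (hN : 2 ^ (n + 2) * K ≤ N) : HalfSmall w (2 * (N + 1)) := by
  intro a h hh E hE hvol
  refine (hw.lintegral_inter_le_of_volume_le hN0 hN a hh hE 2 hvol).trans (le_of_eq ?_)
  congr 1
  rw [pow_two, ← mul_assoc, ENNReal.mul_inv_cancel (by norm_num) (by norm_num), one_mul]

/-- A cube that fills most of a larger cube carries at least half of its mass. -/
lemma lintegral_le_two_mul (hw : AInfBound w K) {m : ℕ} (hm : HalfSmall w m)
    {a b : Fin n → ℝ} {h k : ℝ} (hh : 0 < h) (hk : 0 < k) (hsub : hbox a h ⊆ hbox b k)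
    (hvol : k ^ n ≤ h ^ n + (1 / 2) ^ m * k ^ n) :
    ∫⁻ y in hbox b k, w y ≤ 2 * ∫⁻ y in hbox a h, w y := by
  have hma := measurableSet_hbox a h
  have h2 : (2⁻¹ : ℝ≥0∞) = ENNReal.ofReal (1 / 2) := by
    rw [one_div, ENNReal.ofReal_inv_of_pos (by norm_num)]
    norm_num
  have h1 : volume (hbox b k ∩ (hbox a h)ᶜ) ≤ 2⁻¹ ^ m * volume (hbox b k) := by
    rw [← sdiff_eq, measure_sdiff hsub hma.nullMeasurableSet (volume_hbox_ne_top a h),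
      volume_hbox, volume_hbox, tsub_le_iff_right, h2, ← ENNReal.ofReal_pow hk.le,
      ← ENNReal.ofReal_pow hh.le, ← ENNReal.ofReal_pow (by norm_num),
      ← ENNReal.ofReal_mul (by positivity), ← ENNReal.ofReal_add (by positivity) (by positivity)]
    exact ENNReal.ofReal_le_ofReal (by linarith)
  have h3 := hm b k hk _ hma.compl h1
  have h4 := lintegral_inter_add_sdiff (μ := volume) w (hbox b k) hma
  rw [inter_eq_self_of_subset_right hsub] at h4
  rw [← sdiff_eq] at h3
  set I := ∫⁻ y in hbox b k, w y with hI
  have hIfin : I ≠ ∞ := hw.fin b k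
  have h5 : 2⁻¹ * I + 2⁻¹ * I ≤ (∫⁻ y in hbox a h, w y) + 2⁻¹ * I := by
    rw [← add_mul, ENNReal.inv_two_add_inv_two, one_mul]
    exact h4.symm.le.trans (by gcongr)
  have h6 : 2⁻¹ * I ≤ ∫⁻ y in hbox a h, w y :=
    (ENNReal.add_le_add_iff_right (ENNReal.mul_ne_top (by norm_num) hIfin)).1 h5
  calc I = 2 * (2⁻¹ * I) := by
        rw [← mul_assoc, ENNReal.mul_inv_cancel (by norm_num) (by norm_num), one_mul]
    _ ≤ _ := by gcongr

/-- Doubling, with an explicit constant. -/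
lemma lintegral_hbox_two_mul_le (hw : AInfBound w K) {m : ℕ} (hm : HalfSmall w m)
    {a b : Fin n → ℝ} {h : ℝ} (hh : 0 < h) (hba : ∀ i, b i ≤ a i)
    (hab : ∀ i, a i ≤ b i + h) :
    ∫⁻ y in hbox b (2 * h), w y ≤ 2 ^ (n * 2 ^ m + 1) * ∫⁻ y in hbox a h, w y := by
  set M : ℕ := n * 2 ^ m + 1 with hM
  have hM0 : (0 : ℝ) < M := by rw [hM]; positivity
  let c : ℕ → Fin n → ℝ := fun j i => a i + j / M * (b i - a i)
  let s : ℕ → ℝ := fun j => h * (1 + j / M)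
  have hs : ∀ j, 0 < s j := fun j => by positivity
  have key : ∀ j, ∫⁻ y in hbox (c j) (s j), w y ≤ 2 ^ j * ∫⁻ y in hbox a h, w y := by
    intro j
    induction j with
    | zero => simp [c, s]
    | succ j ih =>
      rw [pow_succ', mul_assoc]
      refine le_trans ?_ (mul_le_mul_right ih 2)
      have hstep : ((j + 1 : ℕ) : ℝ) / M = j / M + 1 / M := by push_cast; ring
      have hinv : 0 < 1 / (M : ℝ) := by positivity
      refine hw.lintegral_le_two_mul hm (hs j) (hs (j + 1)) ?_ ?_
      · intro x hx
        rw [mem_hbox] at hx ⊢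
        intro i
        obtain ⟨h1, h2⟩ := hx i
        simp only [c, s, hstep] at h1 h2 ⊢
        have := mul_nonneg hinv.le (sub_nonneg.2 (hba i))
        have := mul_nonneg hinv.le (sub_nonneg.2 (hab i))
        constructor <;> nlinarith
      · have hr : (1 - 1 / (M : ℝ)) * s (j + 1) ≤ s j := by
          simp only [s, hstep]
          have : 0 ≤ (j : ℝ) / M := by positivity
          have := mul_nonneg this (mul_nonneg hinv.le hh.le)
          have := mul_nonneg hinv.le (mul_nonneg hinv.le hh.le)
          nlinarith
        have hM1 : 1 / (M : ℝ) ≤ 1 := by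
          rw [div_le_one hM0, hM]; push_cast; linarith [show (0 : ℝ) ≤ n * 2 ^ m by positivity]
        have hpow : (1 - 1 / (M : ℝ)) ^ n * s (j + 1) ^ n ≤ s j ^ n := by
          rw [← mul_pow]
          exact pow_le_pow_left₀ (mul_nonneg (by linarith) (hs _).le) hr n
        have hB : 1 - (1 / 2 : ℝ) ^ m ≤ (1 - 1 / (M : ℝ)) ^ n := by
          have := one_add_mul_le_pow (a := -(1 / (M : ℝ))) (by linarith) n
          have h3 : (n : ℝ) * (1 / M) ≤ (1 / 2) ^ m := by
            rw [mul_one_div, div_le_iff₀ hM0, one_div, inv_pow, ← div_eq_inv_mul,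
              le_div_iff₀ (by positivity), hM]
            push_cast
            linarith
          calc _ ≤ 1 + n * -(1 / (M : ℝ)) := by linarith
            _ ≤ _ := this
            _ = _ := by ring
        have := mul_le_mul_of_nonneg_right hB (pow_pos (hs (j + 1)) n).le
        linarith
  have hfin := key M
  have e1 : c M = b := by
    funext i
    simp only [c, div_self hM0.ne']
    ring
  have e2 : s M = 2 * h := by
    simp only [s, div_self hM0.ne']
    ring
  rwa [e1, e2] at hfin

lemma avg_le_avg_succ (hw : AInfBound w K) {m : ℕ} (hm : HalfSmall w m) (D : Grid n)
    (k : ℕ) (x : Fin n → ℝ) :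
    D.avg w k x ≤ 2 ^ (n * 2 ^ m + 1) * D.avg w (k + 1) x := by
  have hside : D.side k = 2 * D.side (k + 1) := by
    simp only [Grid.side]; field_simp; ring
  have hs := D.side_pos (k + 1)
  have h1 : ∫⁻ y in D.cell k x, w y ≤
      2 ^ (n * 2 ^ m + 1) * ∫⁻ y in D.cell (k + 1) x, w y := by
    have := hw.lintegral_hbox_two_mul_le hm (a := D.corner (k + 1) (D.idx (k + 1) x))
      (b := D.corner k (D.idx k x)) hs ?_ ?_
    · rw [← hside] at this
      exact this
    · intro i
      have h3 : 2 * (D.idx (k + 1) x i / 2) ≤ D.idx (k + 1) x i := by omega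
      have h3' : 2 * ((D.idx (k + 1) x i / 2 : ℤ) : ℝ) ≤ D.idx (k + 1) x i := by exact_mod_cast h3
      simp only [Grid.corner, D.idx_succ k, hside]
      have := mul_le_mul_of_nonneg_left h3' hs.le
      linarith
    · intro i
      have h3 : D.idx (k + 1) x i ≤ 2 * (D.idx (k + 1) x i / 2) + 1 := by omega
      have h3' : (D.idx (k + 1) x i : ℝ) ≤ 2 * ((D.idx (k + 1) x i / 2 : ℤ) : ℝ) + 1 := by
        exact_mod_cast h3
      simp only [Grid.corner, D.idx_succ k, hside]
      have := mul_le_mul_of_nonneg_left h3' hs.le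
      linarith
  unfold Grid.avg cubeAvg
  rw [← mul_div_assoc]
  refine (ENNReal.div_le_div_left
    (measure_mono (D.cell_subset k.le_succ x)) _).trans (ENNReal.div_le_div_right h1 _)

end AInfBound

namespace AInfBound

variable {w : (Fin n → ℝ) → ℝ≥0∞} {K : ℝ≥0∞}

/-- The part of the top cell of `D` where some average of `w` is at most `t`. -/
def lowSet (w : (Fin n → ℝ) → ℝ≥0∞) (D : Grid n) (t : ℝ≥0∞) : ℕ → (Fin n → ℝ) → Prop :=
  fun k x => x ∈ hbox D.a D.h ∧ D.avg w k x ≤ t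

lemma adapted_lowSet (w : (Fin n → ℝ) → ℝ≥0∞) (D : Grid n) (t : ℝ≥0∞) :
    D.Adapted (lowSet w D t) := by
  rintro k x y hy ⟨h1, h2⟩
  refine ⟨?_, by rwa [Grid.avg_eq hy]⟩
  rw [← D.cell_zero h1]
  exact D.cell_subset k.zero_le x hy

lemma volume_lowSet_le (hw : AInfBound w K) {m : ℕ} (hm : HalfSmall w m) (D : Grid n)
    {t : ℝ≥0∞} (ht : t ≤ cubeAvg w (hbox D.a D.h)) :
    volume (Grid.hit (lowSet w D (2⁻¹ ^ (n * 2 ^ m + 3) * t))) ≤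
      (1 - 2⁻¹ ^ m) * volume (Grid.hit (lowSet w D t)) := by
  set L := n * 2 ^ m + 1 with hL
  set t' := (2⁻¹ : ℝ≥0∞) ^ (n * 2 ^ m + 3) * t with ht'
  have htt : t' ≤ t := mul_le_of_le_one_left zero_le
    (pow_le_one₀ zero_le (by norm_num))
  have hmeas := (adapted_lowSet w D t').measurableSet_hit
  have hsub : Grid.hit (lowSet w D t') ⊆ Grid.hit (lowSet w D t) := by
    rintro x ⟨k, hk1, hk2⟩
    exact ⟨k, hk1, hk2.trans htt⟩
  have key := (adapted_lowSet w D t).lintegral_hit_le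
    (F := (Grid.hit (lowSet w D t')).indicator fun _ => 1) (H := fun _ => 1 - 2⁻¹ ^ m) ?_
  · rw [setLIntegral_indicator hmeas, inter_eq_left.2 hsub, setLIntegral_const,
      setLIntegral_const, one_mul] at key
    exact key
  rintro k x ⟨hxQ, hx⟩ hfirst
  rw [setLIntegral_indicator hmeas, setLIntegral_const, setLIntegral_const, one_mul]
  by_contra hcon
  rw [not_le] at hcon
  have hgt : ∀ y ∈ D.cell k x, ∀ j < k, t < D.avg w j y := fun y hy j hj => by
    rw [Grid.avg_eq (D.cell_subset hj.le x hy)]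
    by_contra h
    exact hfirst j hj ⟨hxQ, not_lt.1 h⟩
  -- the mass of the low part of the cell
  let P : ℕ → (Fin n → ℝ) → Prop := fun j y => k ≤ j ∧ y ∈ D.cell k x ∧ D.avg w j y ≤ t'
  have hP : D.Adapted P := by
    rintro j y z hz ⟨h1, h2, h3⟩
    refine ⟨h1, ?_, by rwa [Grid.avg_eq hz]⟩
    rw [← D.cell_eq h2]
    exact D.cell_subset h1 y hz
  have hcellQ : D.cell k x ⊆ hbox D.a D.h := by
    rw [← D.cell_zero hxQ]
    exact D.cell_subset k.zero_le x
  have hhit : D.cell k x ∩ Grid.hit (lowSet w D t') = Grid.hit P := by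
    ext y
    constructor
    · rintro ⟨hy, j, -, hj⟩
      refine ⟨j, ?_, hy, hj⟩
      by_contra hjk
      exact absurd (hj.trans htt) (not_le.2 (hgt y hy j (not_le.1 hjk)))
    · rintro ⟨j, -, hy, hj⟩
      exact ⟨hy, j, hcellQ hy, hj⟩
  have hlow : ∫⁻ y in D.cell k x ∩ Grid.hit (lowSet w D t'), w y ≤
      t' * volume (D.cell k x) := by
    have h1 : ∫⁻ y in Grid.hit P, w y ≤ ∫⁻ y in Grid.hit P, (fun _ => t') y := by
      refine hP.lintegral_hit_le fun j y hy _ => ?_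
      rw [setLIntegral_const, D.lintegral_cell]
      gcongr
      exact hy.2.2
    rw [← hhit, setLIntegral_const] at h1
    refine h1.trans ?_
    gcongr
    exact inter_subset_left
  have htavg : t ≤ 2 ^ L * D.avg w k x := by
    cases k with
    | zero =>
      have : D.avg w 0 x = cubeAvg w (hbox D.a D.h) := by rw [← D.cell_zero hxQ]; rfl
      rw [this]
      exact ht.trans (le_mul_of_one_le_left zero_le (one_le_pow₀ (by norm_num)))
    | succ k =>
      exact (hgt x (D.mem_cell_self _ x) k k.lt_succ_self).le.trans (hw.avg_le_avg_succ hm D k x)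
  have ht'avg : t' ≤ 2⁻¹ * (2⁻¹ * D.avg w k x) := by
    calc t' ≤ 2⁻¹ ^ (n * 2 ^ m + 3) * (2 ^ L * D.avg w k x) := by rw [ht']; gcongr
      _ = (2⁻¹ ^ L * 2 ^ L) * (2⁻¹ * (2⁻¹ * D.avg w k x)) := by
        rw [show n * 2 ^ m + 3 = L + 2 from rfl, pow_add]; ring
      _ = _ := by rw [inv_two_pow_mul, one_mul]
  set I := ∫⁻ y in D.cell k x, w y with hI
  have hIfin : I ≠ ∞ := hw.fin _ _
  have hI0 : I ≠ 0 := hw.lintegral_hbox_ne_zero _ (D.side_pos k)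
  have hlow' : ∫⁻ y in D.cell k x ∩ Grid.hit (lowSet w D t'), w y ≤ 2⁻¹ * (2⁻¹ * I) := by
    refine hlow.trans ?_
    rw [hI, D.lintegral_cell, ← mul_assoc, ← mul_assoc]
    gcongr
    rwa [mul_assoc]
  have hJfin := D.volume_cell_ne_top k x
  have hhigh := hm _ _ (D.side_pos k) _ hmeas.compl (by
    change volume (D.cell k x ∩ _) ≤ _ * volume (D.cell k x)
    have h1 := measure_inter_add_sdiff (μ := volume) (D.cell k x) hmeas
    rw [← sdiff_eq]
    have h2 : (1 - 2⁻¹ ^ m) * volume (D.cell k x) + 2⁻¹ ^ m * volume (D.cell k x) =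
        volume (D.cell k x) := by
      rw [← add_mul, tsub_add_cancel_of_le (pow_le_one₀ zero_le (by norm_num)), one_mul]
    have h3 : (1 - 2⁻¹ ^ m) * volume (D.cell k x) ≠ ∞ :=
      ENNReal.mul_ne_top (ENNReal.sub_ne_top (by norm_num)) hJfin
    refine (ENNReal.add_le_add_iff_left h3).1 ?_
    rw [h2]
    nth_rewrite 2 [← h1]
    gcongr
    rw [inter_comm]
    exact hcon.le)
  change ∫⁻ y in D.cell k x ∩ _, w y ≤ 2⁻¹ * I at hhigh
  rw [← sdiff_eq] at hhigh
  have h4 := lintegral_inter_add_sdiff (μ := volume) w (D.cell k x) hmeas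
  have h5 : I ≤ 2⁻¹ * (2⁻¹ * I) + 2⁻¹ * I := h4.symm.le.trans (add_le_add hlow' hhigh)
  have h6 : 2⁻¹ * I ≤ 2⁻¹ * (2⁻¹ * I) := by
    refine (ENNReal.add_le_add_iff_right (ENNReal.mul_ne_top (by norm_num) hIfin)).1
      (le_trans (le_of_eq ?_) h5)
    rw [← add_mul, ENNReal.inv_two_add_inv_two, one_mul]
  have h7 : 2⁻¹ * I < I := by
    rw [mul_comm, ← div_eq_mul_inv]
    exact ENNReal.half_lt_self hI0 hIfin
  have h8 : 2⁻¹ * (2⁻¹ * I) < 2⁻¹ * I :=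
    (ENNReal.mul_lt_mul_iff_right (by norm_num) (by norm_num)).2 h7
  exact absurd h6 (not_le.2 h8)

lemma one_sub_inv_two_pow_le (m : ℕ) : ((1 : ℝ≥0∞) - 2⁻¹ ^ m) ^ (2 ^ m) ≤ 2⁻¹ := by
  have h2 : (2⁻¹ : ℝ≥0∞) = ENNReal.ofReal (1 / 2) := by
    rw [one_div, ENNReal.ofReal_inv_of_pos (by norm_num)]
    norm_num
  have hle : (1 / 2 : ℝ) ^ m ≤ 1 := pow_le_one₀ (by norm_num) (by norm_num)
  rw [h2, ← ENNReal.ofReal_pow (by norm_num), ← ENNReal.ofReal_one,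
    ← ENNReal.ofReal_sub _ (by positivity), ← ENNReal.ofReal_pow (by linarith)]
  refine ENNReal.ofReal_le_ofReal ?_
  have h3 := Real.one_sub_div_pow_le_exp_neg (n := 2 ^ m) (t := 1) (by
    push_cast; exact one_le_pow₀ (by norm_num))
  have h4 : (1 / 2 : ℝ) ^ m = 1 / ((2 ^ m : ℕ) : ℝ) := by
    push_cast
    rw [one_div_pow]
  rw [h4]
  refine h3.trans ?_
  rw [Real.exp_neg, one_div]
  exact inv_anti₀ (by norm_num) (by linarith [Real.add_one_le_exp (1 : ℝ)])

/-- An `A_∞` weight is rarely much smaller than its average. -/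
lemma volume_lt_le (hw : AInfBound w K) {m : ℕ} (hm : HalfSmall w m) (a : Fin n → ℝ) {h : ℝ}
    (hh : 0 < h) (r : ℕ) :
    volume (hbox a h ∩ {x | w x < 2⁻¹ ^ ((n * 2 ^ m + 3) * 2 ^ m * r) * cubeAvg w (hbox a h)}) ≤
      2⁻¹ ^ r * volume (hbox a h) := by
  let D : Grid n := ⟨a, h, hh⟩
  set L := n * 2 ^ m + 3 with hL
  set c := cubeAvg w (hbox a h) with hc
  have hdecay : ∀ i : ℕ, volume (Grid.hit (lowSet w D (2⁻¹ ^ (L * i) * c))) ≤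
      (1 - 2⁻¹ ^ m) ^ i * volume (hbox a h) := by
    intro i
    induction i with
    | zero =>
      rw [pow_zero, one_mul]
      exact measure_mono fun x ⟨k, hk, _⟩ => hk
    | succ i ih =>
      have h1 := hw.volume_lowSet_le hm D (t := 2⁻¹ ^ (L * i) * c)
        (mul_le_of_le_one_left zero_le (pow_le_one₀ zero_le (by norm_num)))
      rw [← hL, ← mul_assoc, ← pow_add, show L + L * i = L * (i + 1) by ring] at h1
      rw [pow_succ', mul_assoc]
      exact h1.trans (by gcongr)
  have hdecay' := hdecay (2 ^ m * r)
  rw [← mul_assoc] at hdecay'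
  refine (le_trans (measure_mono_ae ?_) hdecay').trans ?_
  · filter_upwards [D.ae_tendsto_avg hw.meas hw.fin] with x hx hx'
    obtain ⟨k, hk⟩ := ((hx hx'.1).eventually (gt_mem_nhds hx'.2)).exists
    exact ⟨k, hx'.1, hk.le⟩
  · rw [pow_mul]
    gcongr
    exact one_sub_inv_two_pow_le m

end AInfBound

lemma tsum_two_inv_pow_div_le {Z : ℕ} (hZ : Z ≠ 0) :
    ∑' l : ℤ, 2 * (2⁻¹ : ℝ≥0∞) ^ (l.natAbs / Z) ≤ 8 * Z := by
  have : NeZero Z := ⟨hZ⟩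
  have hnat : ∑' k : ℕ, (2⁻¹ : ℝ≥0∞) ^ (k / Z) = 2 * Z := by
    rw [← (Nat.divModEquiv Z).symm.tsum_eq, ENNReal.summable.tsum_prod' fun _ => ENNReal.summable]
    have : ∀ (q : ℕ) (r : Fin Z),
        (2⁻¹ : ℝ≥0∞) ^ ((Nat.divModEquiv Z).symm (q, r) / Z) = 2⁻¹ ^ q := by
      intro q r
      congr 1
      have := congrArg Prod.fst ((Nat.divModEquiv Z).apply_symm_apply (q, r))
      simpa [Nat.divModEquiv] using this
    simp only [this, tsum_fintype, Finset.sum_const, Finset.card_univ, Fintype.card_fin,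
      nsmul_eq_mul]
    rw [ENNReal.tsum_mul_left, ENNReal.tsum_geometric, ENNReal.one_sub_inv_two, inv_inv, mul_comm]
  rw [ENNReal.tsum_mul_left, ← Equiv.intEquivNatSumNat.symm.tsum_eq,
    Summable.tsum_sum ENNReal.summable ENNReal.summable]
  have h1 : ∀ k : ℕ, (2⁻¹ : ℝ≥0∞) ^ ((Equiv.intEquivNatSumNat.symm (Sum.inl k)).natAbs / Z) =
      2⁻¹ ^ (k / Z) := fun k => rfl
  have h2 : ∀ k : ℕ, (2⁻¹ : ℝ≥0∞) ^ ((Equiv.intEquivNatSumNat.symm (Sum.inr k)).natAbs / Z) ≤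
      2⁻¹ ^ (k / Z) := fun k => by
    refine pow_le_pow_right_of_le_one' (by norm_num) (Nat.div_le_div_right ?_)
    change k ≤ (Int.negSucc k).natAbs
    simp
  simp only [h1]
  refine (mul_le_mul_right (add_le_add hnat.le ((ENNReal.tsum_le_tsum h2).trans hnat.le)) 2).trans
    (le_of_eq (by ring))

lemma two_inv_pow_eq_zpow (k : ℕ) : (2⁻¹ : ℝ≥0∞) ^ k = 2 ^ (-(k : ℤ)) := by
  rw [ENNReal.zpow_neg, zpow_natCast, ENNReal.inv_pow]

lemma two_zpow_add (i j : ℤ) : (2 : ℝ≥0∞) ^ (i + j) = 2 ^ i * 2 ^ j :=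
  ENNReal.zpow_add (by norm_num) (by norm_num) i j

lemma two_zpow_ne_zero (i : ℤ) : (2 : ℝ≥0∞) ^ i ≠ 0 :=
  (ENNReal.zpow_pos (by norm_num) (by norm_num) i).ne'

lemma two_zpow_ne_top (i : ℤ) : (2 : ℝ≥0∞) ^ i ≠ ∞ :=
  ENNReal.zpow_ne_top (by norm_num) (by norm_num) i

lemma two_zpow_le {i j : ℤ} (hij : i ≤ j) : (2 : ℝ≥0∞) ^ i ≤ 2 ^ j :=
  ENNReal.zpow_le_of_le (by norm_num) hij

/-- The set where `w` is comparable to `2 ^ i`. -/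
def slice (w : (Fin n → ℝ) → ℝ≥0∞) (i : ℤ) : Set (Fin n → ℝ) :=
  {x | 2 ^ i ≤ w x ∧ w x < 2 ^ (i + 1)}

lemma measurableSet_slice {w : (Fin n → ℝ) → ℝ≥0∞} (hw : Measurable w) (i : ℤ) :
    MeasurableSet (slice w i) :=
  (measurableSet_le measurable_const hw).inter (measurableSet_lt hw measurable_const)

/-- On a cube where the average of `V` is far from `2 ^ i`, the set where `V` is comparable to
`2 ^ i` has small `U`-mass. -/
lemma lintegral_inter_slice_le {U V : (Fin n → ℝ) → ℝ≥0∞} {K B : ℝ≥0∞} (hU : AInfBound U K)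
    (hV : AInfBound V B) {N m : ℕ} (hN0 : N ≠ 0) (hN : 2 ^ (n + 2) * K ≤ N)
    (hm : HalfSmall V m) (a : Fin n → ℝ) {h : ℝ} (hh : 0 < h) {i l : ℤ}
    (hl : 2 ^ (i + l) ≤ cubeAvg V (hbox a h)) (hl' : cubeAvg V (hbox a h) < 2 ^ (i + l + 1)) :
    ∫⁻ y in hbox a h ∩ slice V i, U y ≤
      2 * 2⁻¹ ^ (l.natAbs / ((n * 2 ^ m + 3) * 2 ^ m * (N + 1) + 1)) * ∫⁻ y in hbox a h, U y := by
  set W := (n * 2 ^ m + 3) * 2 ^ m with hW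
  set q := l.natAbs / (W * (N + 1) + 1) with hq
  have hSm := measurableSet_slice hV.meas i
  rcases Nat.eq_zero_or_pos q with h0 | hqpos
  · rw [h0, pow_zero, mul_one]
    exact (lintegral_mono_set inter_subset_left).trans
      (le_mul_of_one_le_left zero_le (by norm_num))
  refine hU.lintegral_inter_le_of_volume_le hN0 hN a hh hSm q ?_
  set r := q * (N + 1) with hr
  have hql : W * r + 1 ≤ l.natAbs := by
    have h1 : q * (W * (N + 1) + 1) ≤ l.natAbs := Nat.div_mul_le_self _ _
    have h2 : q * (W * (N + 1) + 1) = W * r + q := by rw [hr]; ring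
    omega
  have hW1 : 1 ≤ W := Nat.mul_pos (by positivity) (by positivity)
  rcases le_total 0 l with hpos | hneg
  · refine le_trans (measure_mono ?_) (hV.volume_lt_le hm a hh r)
    rintro x ⟨hx, -, hx2⟩
    refine ⟨hx, hx2.trans_le ?_⟩
    rw [two_inv_pow_eq_zpow]
    refine le_trans ?_ (mul_le_mul_right hl _)
    rw [← two_zpow_add]
    refine two_zpow_le ?_
    have : ((W * r + 1 : ℕ) : ℤ) ≤ l.natAbs := by exact_mod_cast hql
    rw [← hW]
    push_cast at this ⊢
    rw [abs_of_nonneg hpos] at this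
    linarith
  · have h1 : 2 ^ i * volume (hbox a h ∩ slice V i) ≤ 2 ^ (i + l + 1) * volume (hbox a h) := by
      rw [← setLIntegral_const]
      refine (setLIntegral_mono hV.meas fun x hx => hx.2.1).trans ?_
      refine (lintegral_mono_set inter_subset_left).trans ?_
      rw [← lintegral_hbox_eq V a hh]
      gcongr
    have h2 : i + l + 1 = i + (l + 1) := by ring
    rw [h2, two_zpow_add, mul_assoc,
      ENNReal.mul_le_mul_iff_right (two_zpow_ne_zero i) (two_zpow_ne_top i)] at h1
    refine h1.trans ?_
    gcongr
    rw [two_inv_pow_eq_zpow]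
    refine two_zpow_le ?_
    have h3 : r ≤ W * r := Nat.le_mul_of_pos_left r hW1
    have h4 : r + 1 ≤ l.natAbs := by omega
    have : ((r + 1 : ℕ) : ℤ) ≤ l.natAbs := by exact_mod_cast h4
    push_cast at this
    rw [abs_of_nonpos hneg] at this
    linarith

/-- The joint stopping condition for `G`, `U` and `V`. -/
def Selected (D : Grid n) (G U V : (Fin n → ℝ) → ℝ≥0∞) (l s i : ℤ) (k : ℕ) (x : Fin n → ℝ) : Prop :=
  2 ^ i ≤ D.avg G k x ∧ (2 ^ (i + l) ≤ D.avg V k x ∧ D.avg V k x < 2 ^ (i + l + 1)) ∧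
    2 ^ s ≤ D.avg U k x ∧ D.avg U k x < 2 ^ (s + 1)

section Selected

variable {D : Grid n} {G U V : (Fin n → ℝ) → ℝ≥0∞} {A K B : ℝ≥0∞}

lemma adapted_selected (l s i : ℤ) : D.Adapted (Selected D G U V l s i) := by
  intro k x y hy h
  unfold Selected at *
  rwa [Grid.avg_eq hy, Grid.avg_eq hy, Grid.avg_eq hy]

lemma adapted_exists_selected (l s : ℤ) : D.Adapted fun k x => ∃ i, Selected D G U V l s i k x :=
  fun k x y hy ⟨i, hi⟩ => ⟨i, adapted_selected l s i k x y hy hi⟩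

lemma exists_two_zpow {t : ℝ≥0∞} (h0 : t ≠ 0) (ht : t ≠ ∞) :
    ∃ i : ℤ, 2 ^ i ≤ t ∧ t < 2 ^ (i + 1) :=
  ENNReal.exists_mem_Ico_zpow h0 ht (by norm_num) (by norm_num)

lemma subset_iUnion_selected (hU : AInfBound U K) (hV : AInfBound V B) (hVt : ∀ x, V x ≠ ∞) :
    {x | ∃ k, V x < D.avg G k x} ⊆
      ⋃ (l : ℤ) (s : ℤ) (i : ℤ), Grid.hit (Selected D G U V l s i) ∩ slice V i := by
  rintro x ⟨k, hk⟩
  obtain ⟨i, hi1, hi2⟩ := exists_two_zpow (hV.pos x) (hVt x)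
  obtain ⟨j, hj⟩ := exists_two_zpow (hV.avg_ne_zero D k x) (hV.avg_ne_top D k x)
  obtain ⟨s, hs⟩ := exists_two_zpow (hU.avg_ne_zero D k x) (hU.avg_ne_top D k x)
  simp only [mem_iUnion]
  refine ⟨j - i, s, i, ⟨k, hi1.trans hk.le, ?_, hs⟩, hi1, hi2⟩
  rwa [show i + (j - i) = j by ring]

lemma lintegral_selected_inter_slice_le (hU : AInfBound U K) (hV : AInfBound V B) {N m : ℕ}
    (hN0 : N ≠ 0) (hN : 2 ^ (n + 2) * K ≤ N) (hm : HalfSmall V m) (l s i : ℤ) :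
    ∫⁻ x in Grid.hit (Selected D G U V l s i) ∩ slice V i, U x * V x ≤
      4 * (2 * 2⁻¹ ^ (l.natAbs / ((n * 2 ^ m + 3) * 2 ^ m * (N + 1) + 1))) *
        (2 ^ s * (2 ^ i * volume (Grid.hit (Selected D G U V l s i)))) := by
  set φ : ℝ≥0∞ := 2 * 2⁻¹ ^ (l.natAbs / ((n * 2 ^ m + 3) * 2 ^ m * (N + 1) + 1)) with hφ
  have hSm := measurableSet_slice hV.meas i
  have hHm := (adapted_selected (D := D) (G := G) (U := U) (V := V) l s i).measurableSet_hit
  have h1 : ∫⁻ x in Grid.hit (Selected D G U V l s i) ∩ slice V i, U x * V x ≤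
      2 ^ (i + 1) * ∫⁻ x in Grid.hit (Selected D G U V l s i) ∩ slice V i, U x := by
    rw [← lintegral_const_mul _ hU.meas]
    refine setLIntegral_mono' (hHm.inter hSm) fun x hx => ?_
    rw [mul_comm]
    exact mul_le_mul_left hx.2.2.le _
  have h2 := (adapted_selected (D := D) (G := G) (U := U) (V := V) l s i).lintegral_hit_le
    (F := (slice V i).indicator U) (H := fun _ => φ * 2 ^ (s + 1)) ?_
  · rw [setLIntegral_indicator hSm, setLIntegral_const, inter_comm] at h2
    refine h1.trans ((mul_le_mul_right h2 _).trans (le_of_eq ?_))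
    rw [two_zpow_add, two_zpow_add, zpow_one]
    ring
  rintro k x ⟨-, hkV, hkU⟩ -
  rw [setLIntegral_indicator hSm, setLIntegral_const, inter_comm]
  refine (lintegral_inter_slice_le hU hV hN0 hN hm _ (D.side_pos k) hkV.1 hkV.2).trans ?_
  change φ * ∫⁻ y in D.cell k x, U y ≤ _
  rw [D.lintegral_cell, ← mul_assoc]
  gcongr
  exact hkU.2.le

lemma tsum_volume_selected_le (hG : Measurable G) (hV : AInfBound V B) (l s : ℤ) :
    ∑' i : ℤ, 2 ^ i * volume (Grid.hit (Selected D G U V l s i)) ≤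
      4 * B * ∫⁻ x in Grid.hit (fun k x => ∃ i, Selected D G U V l s i k x), G x := by
  have hHm := fun i => (adapted_selected (D := D) (G := G) (U := U) (V := V) l s i).measurableSet_hit
  have hsub : ∀ i, Grid.hit (Selected D G U V l s i) ⊆
      Grid.hit (fun k x => ∃ i, Selected D G U V l s i k x) := fun i x ⟨k, hk⟩ => ⟨k, i, hk⟩
  have h1 := (adapted_exists_selected (D := D) (G := G) (U := U) (V := V) l s).lintegral_hit_le
    (F := fun y => ∑' i : ℤ, (Grid.hit (Selected D G U V l s i)).indicator (fun _ => (2 : ℝ≥0∞) ^ i) y)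
    (H := fun y => 4 * B * G y) ?_
  · rw [lintegral_tsum fun i => (measurable_const.indicator (hHm i)).aemeasurable,
      lintegral_const_mul _ hG] at h1
    refine le_trans (ENNReal.tsum_le_tsum fun i => ?_) h1
    rw [setLIntegral_indicator (hHm i), setLIntegral_const, inter_eq_left.2 (hsub i)]
  rintro k x ⟨i₀, hi₀⟩ hfirst
  rw [lintegral_const_mul _ hG, D.lintegral_cell G]
  have hpt : ∀ y ∈ D.cell k x,
      ∑' i : ℤ, (Grid.hit (Selected D G U V l s i)).indicator (fun _ => (2 : ℝ≥0∞) ^ i) y ≤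
        2 ^ (-l) * 2 * ⨆ (j) (_ : k ≤ j), D.avg V j y := by
    intro y hy
    set S := ⨆ (j) (_ : k ≤ j), D.avg V j y with hS
    rw [mul_assoc]
    refine le_trans ?_ (mul_le_mul_right (tsum_two_zpow_le S) _)
    rw [← (Equiv.addRight l).tsum_eq fun i : ℤ => if (2 : ℝ≥0∞) ^ i ≤ S then (2 : ℝ≥0∞) ^ i else 0,
      ← ENNReal.tsum_mul_left]
    refine ENNReal.tsum_le_tsum fun i => ?_
    by_cases hi : y ∈ Grid.hit (Selected D G U V l s i)
    · rw [indicator_of_mem hi]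
      obtain ⟨j, hj⟩ := hi
      have hkj : k ≤ j := by
        by_contra hjk
        exact hfirst j (not_le.1 hjk) ⟨i, adapted_selected l s i j y x
          (D.mem_cell_comm.1 (D.cell_subset (not_le.1 hjk).le x hy)) hj⟩
      rw [Equiv.coe_addRight, if_pos (hj.2.1.1.trans (le_iSup₂_of_le j hkj le_rfl)),
        ← two_zpow_add, show -l + (i + l) = i by ring]
    · rw [indicator_of_notMem hi]
      exact zero_le
  refine (setLIntegral_mono' (D.measurableSet_cell k x) hpt).trans ?_
  rw [lintegral_const_mul' _ _ (ENNReal.mul_ne_top (two_zpow_ne_top _) (by norm_num))]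
  refine (mul_le_mul_right (hV.lintegral_iSup_avg_le D k x) _).trans ?_
  rw [D.lintegral_cell]
  calc 2 ^ (-l) * 2 * (B * (D.avg V k x * volume (D.cell k x)))
      ≤ 2 ^ (-l) * 2 * (B * (2 ^ (i₀ + l + 1) * volume (D.cell k x))) := by
        gcongr
        exact hi₀.2.1.2.le
    _ = 4 * B * ((2 ^ (-l) * 2 ^ (i₀ + l)) * volume (D.cell k x)) := by
        rw [two_zpow_add (i₀ + l), zpow_one]; ring
    _ = 4 * B * (2 ^ i₀ * volume (D.cell k x)) := by
        rw [← two_zpow_add, show -l + (i₀ + l) = i₀ by ring]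
    _ ≤ _ := by
        gcongr
        exact hi₀.1

lemma tsum_lintegral_selected_le (hG : Measurable G) (hU : AInfBound U K)
    (hA : ∀ᵐ x, hlM U x ≤ A * U x) (l : ℤ) :
    ∑' s : ℤ, 2 ^ s * ∫⁻ x in Grid.hit (fun k x => ∃ i, Selected D G U V l s i k x), G x ≤
      2 * A * ∫⁻ x, G x * U x := by
  have hHm := fun s =>
    (adapted_exists_selected (D := D) (G := G) (U := U) (V := V) l s).measurableSet_hit
  have h1 : ∀ s : ℤ, 2 ^ s * ∫⁻ x in Grid.hit (fun k x => ∃ i, Selected D G U V l s i k x), G x =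
      ∫⁻ x, (Grid.hit fun k x => ∃ i, Selected D G U V l s i k x).indicator
        (fun x => 2 ^ s * G x) x := fun s => by
    rw [lintegral_indicator (hHm s), lintegral_const_mul _ hG]
  simp only [h1]
  rw [← lintegral_tsum fun s => ((hG.const_mul _).indicator (hHm s)).aemeasurable,
    ← lintegral_const_mul _ (show Measurable fun x => G x * U x from hG.mul hU.meas)]
  refine lintegral_mono_ae ?_
  filter_upwards [hA] with x hx
  have h2 : ∑' s : ℤ, (Grid.hit fun k x => ∃ i, Selected D G U V l s i k x).indicator
      (fun x => 2 ^ s * G x) x ≤ ∑' s : ℤ, (if (2 : ℝ≥0∞) ^ s ≤ A * U x then 2 ^ s else 0) * G x := by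
    refine ENNReal.tsum_le_tsum fun s => ?_
    by_cases hs : x ∈ Grid.hit (fun k x => ∃ i, Selected D G U V l s i k x)
    · rw [indicator_of_mem hs]
      obtain ⟨k, i, hk⟩ := hs
      rw [if_pos]
      exact hk.2.2.1.trans ((cubeAvg_hbox_le_hlM U (D.side_pos k) (D.mem_cell_self k x)).trans hx)
    · rw [indicator_of_notMem hs]
      exact zero_le
  refine h2.trans ?_
  rw [ENNReal.tsum_mul_right]
  refine (mul_le_mul_left (tsum_two_zpow_le _) _).trans (le_of_eq ?_)
  ring

/-- The mixed weak-type estimate for dyadic averages. -/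
lemma lintegral_avg_gt_le (hG : Measurable G) (hU : AInfBound U K) (hV : AInfBound V B)
    (hVt : ∀ x, V x ≠ ∞) (hA : ∀ᵐ x, hlM U x ≤ A * U x) {N m : ℕ}
    (hN0 : N ≠ 0) (hN : 2 ^ (n + 2) * K ≤ N) (hm : HalfSmall V m) :
    ∫⁻ x in {x | ∃ k, V x < D.avg G k x}, U x * V x ≤
      256 * A * B * ((n * 2 ^ m + 3) * 2 ^ m * (N + 1) + 1 : ℕ) * ∫⁻ x, G x * U x := by
  set Z : ℕ := (n * 2 ^ m + 3) * 2 ^ m * (N + 1) + 1 with hZ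
  calc ∫⁻ x in {x | ∃ k, V x < D.avg G k x}, U x * V x
      ≤ ∑' l : ℤ, ∑' s : ℤ, ∑' i : ℤ,
          ∫⁻ x in Grid.hit (Selected D G U V l s i) ∩ slice V i, U x * V x := by
        refine (lintegral_mono_set (subset_iUnion_selected hU hV hVt)).trans ?_
        refine (lintegral_iUnion_le _ _).trans (ENNReal.tsum_le_tsum fun l => ?_)
        refine (lintegral_iUnion_le _ _).trans (ENNReal.tsum_le_tsum fun s => ?_)
        exact lintegral_iUnion_le _ _
    _ ≤ ∑' l : ℤ, ∑' s : ℤ, ∑' i : ℤ, 4 * (2 * 2⁻¹ ^ (l.natAbs / Z)) *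
          (2 ^ s * (2 ^ i * volume (Grid.hit (Selected D G U V l s i)))) :=
        ENNReal.tsum_le_tsum fun l => ENNReal.tsum_le_tsum fun s => ENNReal.tsum_le_tsum fun i =>
          lintegral_selected_inter_slice_le hU hV hN0 hN hm l s i
    _ ≤ ∑' l : ℤ, ∑' s : ℤ, 4 * (2 * 2⁻¹ ^ (l.natAbs / Z)) * (2 ^ s *
          (4 * B * ∫⁻ x in Grid.hit (fun k x => ∃ i, Selected D G U V l s i k x), G x)) := by
        refine ENNReal.tsum_le_tsum fun l => ENNReal.tsum_le_tsum fun s => ?_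
        rw [ENNReal.tsum_mul_left, ENNReal.tsum_mul_left]
        gcongr
        exact tsum_volume_selected_le hG hV l s
    _ = ∑' l : ℤ, 16 * B * (2 * 2⁻¹ ^ (l.natAbs / Z)) * ∑' s : ℤ, 2 ^ s *
          ∫⁻ x in Grid.hit (fun k x => ∃ i, Selected D G U V l s i k x), G x := by
        refine tsum_congr fun l => ?_
        rw [← ENNReal.tsum_mul_left]
        refine tsum_congr fun s => ?_
        ring
    _ ≤ ∑' l : ℤ, 16 * B * (2 * 2⁻¹ ^ (l.natAbs / Z)) * (2 * A * ∫⁻ x, G x * U x) :=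
        ENNReal.tsum_le_tsum fun l => mul_le_mul_right (tsum_lintegral_selected_le hG hU hA l) _
    _ = 16 * B * (∑' l : ℤ, 2 * 2⁻¹ ^ (l.natAbs / Z)) * (2 * A * ∫⁻ x, G x * U x) := by
        rw [ENNReal.tsum_mul_right, ENNReal.tsum_mul_left]
    _ ≤ 16 * B * (8 * Z) * (2 * A * ∫⁻ x, G x * U x) := by
        gcongr
        exact tsum_two_inv_pow_div_le (by rw [hZ]; positivity)
    _ = _ := by ring

end Selected

lemma floor_eq_or_floor_sub_eq (k : ℕ) (t : ℝ) {r : ℝ} (hr0 : 0 ≤ r) (hr : r < 1 / 3) :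
    ⌊t⌋ = ⌊t + r⌋ ∨ ⌊t - 2 ^ k / 3⌋ = ⌊t + r - 2 ^ k / 3⌋ := by
  have aux : ∀ t : ℝ, ⌊t⌋ ≠ ⌊t + r⌋ → ∃ p : ℤ, t < p ∧ (p : ℝ) ≤ t + r := fun t ht =>
    ⟨⌊t + r⌋, Int.floor_lt.1 (lt_of_le_of_ne (Int.floor_le_floor (by linarith)) ht),
      Int.floor_le _⟩
  by_contra! hcon
  obtain ⟨p, hp1, hp2⟩ := aux _ hcon.1
  obtain ⟨q, hq1, hq2⟩ := aux (t - 2 ^ k / 3) (by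
    rw [show t - 2 ^ k / 3 + r = t + r - 2 ^ k / 3 by ring]; exact hcon.2)
  have h1 : ((3 * (p - q) : ℤ) : ℝ) < ((2 ^ k + 1 : ℤ) : ℝ) := by push_cast; linarith
  have h2 : ((2 ^ k - 1 : ℤ) : ℝ) < ((3 * (p - q) : ℤ) : ℝ) := by push_cast; linarith
  rw [Int.cast_lt] at h1 h2
  have h3 : (3 : ℤ) ∣ 2 ^ k := ⟨p - q, by omega⟩
  have h4 : (3 : ℕ) ∣ 2 ^ k := by exact_mod_cast h3
  have h5 := Nat.Prime.dvd_of_dvd_pow Nat.prime_three h4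
  omega

/-- The grids of mesh `h`, shifted by `h / 3` in the directions selected by `α`. -/
def shiftedGrid (α : Fin n → Bool) {h : ℝ} (hh : 0 < h) : Grid n :=
  ⟨fun i => if α i then h / 3 else 0, h, hh⟩

lemma exists_cell_supset {h : ℝ} (hh : 0 < h) (a : Fin n → ℝ) {l : ℝ} (hl : 0 < l)
    (hlh : l < h / 3) :
    ∃ (α : Fin n → Bool) (k : ℕ), (shiftedGrid α hh).side k ≤ 6 * l ∧
      ∀ x ∈ cbox a l, cbox a l ⊆ (shiftedGrid α hh).cell k x := by
  obtain ⟨k, hk1, hk2⟩ : ∃ k : ℕ, l < h / 2 ^ k / 3 ∧ h / 2 ^ k ≤ 6 * l := by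
    have hex : ∃ k : ℕ, h / 2 ^ k / 3 ≤ l := by
      obtain ⟨k, hk⟩ := exists_pow_lt_of_lt_one (show 0 < 3 * l / h by positivity)
        (show (1 / 2 : ℝ) < 1 by norm_num)
      refine ⟨k, ?_⟩
      rw [lt_div_iff₀ hh, one_div_pow] at hk
      have : h / 2 ^ k = 1 / 2 ^ k * h := by ring
      linarith
    classical
    have hspec := Nat.find_spec hex
    have hmin := fun j => Nat.find_min hex (m := j)
    generalize Nat.find hex = k₀ at hspec hmin
    cases k₀ with
    | zero => simp at hspec; linarith
    | succ k =>
      refine ⟨k, not_le.1 (hmin k k.lt_succ_self), ?_⟩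
      have : h / 2 ^ k = 2 * (h / 2 ^ (k + 1)) := by field_simp; ring
      linarith
  have h2k : (0 : ℝ) < 2 ^ k := by positivity
  have hr0 : 0 ≤ 2 ^ k * (l / h) := by positivity
  have hr : 2 ^ k * (l / h) < 1 / 3 := by
    have : 2 ^ k * (l / h) = l / (h / 2 ^ k) := by field_simp
    rw [this, div_lt_iff₀ (by positivity)]
    linarith
  have hcoord : ∀ i, ∃ b : Bool, ∀ y, a i ≤ y → y ≤ a i + l →
      ⌊2 ^ k * ((y - if b then h / 3 else 0) / h)⌋ =
        ⌊2 ^ k * ((a i - if b then h / 3 else 0) / h)⌋ := by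
    intro i
    have hmono : ∀ c y, a i ≤ y → y ≤ a i + l →
        ⌊2 ^ k * ((a i - c) / h)⌋ = ⌊2 ^ k * ((a i + l - c) / h)⌋ →
        ⌊2 ^ k * ((y - c) / h)⌋ = ⌊2 ^ k * ((a i - c) / h)⌋ := by
      intro c y h1 h2 he
      refine le_antisymm ?_ (Int.floor_le_floor (by gcongr))
      rw [he]
      exact Int.floor_le_floor (by gcongr)
    rcases floor_eq_or_floor_sub_eq k (2 ^ k * (a i / h)) hr0 hr with he | he
    · refine ⟨false, fun y h1 h2 => hmono _ y h1 h2 ?_⟩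
      simp only [Bool.false_eq_true, if_false, sub_zero]
      rw [he]
      congr 1
      ring
    · refine ⟨true, fun y h1 h2 => hmono _ y h1 h2 ?_⟩
      simp only [if_true]
      have e1 : 2 ^ k * ((a i - h / 3) / h) = 2 ^ k * (a i / h) - 2 ^ k / 3 := by field_simp
      have e2 : 2 ^ k * ((a i + l - h / 3) / h) =
          2 ^ k * (a i / h) + 2 ^ k * (l / h) - 2 ^ k / 3 := by field_simp
      rw [e1, e2, he]
  choose α hα using hcoord
  refine ⟨α, k, hk2, fun x hx y hy => ?_⟩
  rw [mem_cbox] at hx hy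
  rw [Grid.mem_cell]
  funext i
  exact (hα i _ (hy i).1 (hy i).2).trans (hα i _ (hx i).1 (hx i).2).symm

lemma volume_cbox (a : Fin n → ℝ) (h : ℝ) : volume (cbox a h) = ENNReal.ofReal h ^ n := by
  rw [← measure_congr (hbox_ae_eq_cbox a h), volume_hbox]

lemma exists_cubeAvg_le_avg {h : ℝ} (hh : 0 < h) (G : (Fin n → ℝ) → ℝ≥0∞) (a : Fin n → ℝ)
    {l : ℝ} (hl : 0 < l) (hlh : l < h / 3) {x : Fin n → ℝ} (hx : x ∈ cbox a l) :
    ∃ (α : Fin n → Bool) (k : ℕ),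
      cubeAvg G (cbox a l) ≤ (shiftedGrid α hh).avg (fun y => 6 ^ n * G y) k x := by
  obtain ⟨α, k, hk, hsub⟩ := exists_cell_supset hh a hl hlh
  refine ⟨α, k, ?_⟩
  set D := shiftedGrid α hh
  have hlpos : ENNReal.ofReal l ≠ 0 := by simpa using hl
  have h6 : (6 : ℝ≥0∞) ^ n ≠ ∞ := ENNReal.pow_ne_top (by norm_num)
  have h60 : (6 : ℝ≥0∞) ^ n ≠ 0 := pow_ne_zero _ (by norm_num)
  have hvol : volume (D.cell k x) ≤ 6 ^ n * volume (cbox a l) := by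
    rw [D.volume_cell, volume_cbox, ← mul_pow]
    gcongr
    refine (ENNReal.ofReal_le_ofReal hk).trans (le_of_eq ?_)
    rw [ENNReal.ofReal_mul (by norm_num)]
    norm_num
  unfold Grid.avg cubeAvg
  rw [lintegral_const_mul' _ _ h6]
  calc (∫⁻ y in cbox a l, G y) / volume (cbox a l)
      = (6 ^ n * ∫⁻ y in cbox a l, G y) / (6 ^ n * volume (cbox a l)) :=
        (ENNReal.mul_div_mul_left _ _ h60 h6).symm
    _ ≤ (6 ^ n * ∫⁻ y in D.cell k x, G y) / volume (D.cell k x) := by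
        refine ENNReal.div_le_div (mul_le_mul_right ?_ _) hvol
        exact lintegral_mono_set (hsub x hx)

/-- The mixed weak-type estimate for everywhere finite and positive weights. -/
lemma lintegral_hlM_gt_le {G U V : (Fin n → ℝ) → ℝ≥0∞} {A K B : ℝ≥0∞} (hG : Measurable G)
    (hU : AInfBound U K) (hV : AInfBound V B) (hVt : ∀ x, V x ≠ ∞)
    (hA : ∀ᵐ x, hlM U x ≤ A * U x) {N m : ℕ}
    (hN0 : N ≠ 0) (hN : 2 ^ (n + 2) * K ≤ N) (hm : HalfSmall V m) :
    ∫⁻ x in {x | V x < hlM G x}, U x * V x ≤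
      2 ^ n * (256 * A * B * ((n * 2 ^ m + 3) * 2 ^ m * (N + 1) + 1 : ℕ) *
        (6 ^ n * ∫⁻ x, G x * U x)) := by
  let T : ℕ → Set (Fin n → ℝ) := fun j => {x | ∃ (a : Fin n → ℝ) (l : ℝ), 0 < l ∧
    l < 2 ^ j / 3 ∧ x ∈ cbox a l ∧ V x < cubeAvg G (cbox a l)}
  have hT : {x | V x < hlM G x} ⊆ ⋃ j, T j := by
    intro x hx
    simp only [mem_ofPred_eq, hlM, lt_iSup_iff] at hx
    obtain ⟨Q, ⟨a, l, hl, rfl⟩, hxQ, hlt⟩ := hx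
    have he : {x | ∀ i, a i ≤ x i ∧ x i ≤ a i + l} = cbox a l := by
      ext y; exact mem_cbox.symm
    rw [he] at hxQ hlt
    obtain ⟨j, hj⟩ := pow_unbounded_of_one_lt (3 * l) (show (1 : ℝ) < 2 by norm_num)
    exact mem_iUnion.2 ⟨j, a, l, hl, by linarith, hxQ, hlt⟩
  have hmono : Monotone T := by
    rintro i j hij x ⟨a, l, hl, hlt, hx⟩
    refine ⟨a, l, hl, hlt.trans_le ?_, hx⟩
    gcongr
    norm_num
  refine (lintegral_mono_set hT).trans ?_
  rw [setLIntegral_iUnion_of_directed _ hmono.directed_le]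
  refine iSup_le fun j => ?_
  have hj : (0 : ℝ) < 2 ^ j := by positivity
  have hsub : T j ⊆ ⋃ α : Fin n → Bool,
      {x | ∃ k, V x < (shiftedGrid α hj).avg (fun y => 6 ^ n * G y) k x} := by
    rintro x ⟨a, l, hl, hlt, hx, hVx⟩
    obtain ⟨α, k, hk⟩ := exists_cubeAvg_le_avg hj G a hl hlt hx
    exact mem_iUnion.2 ⟨α, k, hVx.trans_le hk⟩
  refine (lintegral_mono_set hsub).trans ((lintegral_iUnion_le _ _).trans ?_)
  rw [tsum_fintype]
  refine (Finset.sum_le_sum fun α _ =>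
    lintegral_avg_gt_le (D := shiftedGrid α hj) (hG.const_mul (6 ^ n)) hU hV hVt hA hN0 hN hm).trans
    (le_of_eq ?_)
  rw [Finset.sum_const, Finset.card_univ, Fintype.card_fun, Fintype.card_bool, Fintype.card_fin,
    nsmul_eq_mul]
  push_cast
  congr 2
  rw [← lintegral_const_mul' _ _ (ENNReal.pow_ne_top (by norm_num))]
  refine lintegral_congr fun x => ?_
  ring

lemma cubeAvg_congr {f g : (Fin n → ℝ) → ℝ≥0∞} (h : f =ᵐ[volume] g) (Q : Set (Fin n → ℝ)) :
    cubeAvg f Q = cubeAvg g Q := by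
  unfold cubeAvg
  rw [lintegral_congr_ae (ae_restrict_of_ae h)]

lemma hlM_congr {f g : (Fin n → ℝ) → ℝ≥0∞} (h : f =ᵐ[volume] g) : hlM f = hlM g := by
  funext x
  simp only [hlM, cubeAvg_congr h]

lemma hlM_mono {f g : (Fin n → ℝ) → ℝ≥0∞} (h : f ≤ g) (x : Fin n → ℝ) : hlM f x ≤ hlM g x :=
  iSup_mono fun _ => iSup₂_mono fun _ _ => ENNReal.div_le_div_right (lintegral_mono h) _

lemma hlM_const_mul (f : (Fin n → ℝ) → ℝ≥0∞) {c : ℝ≥0∞} (hc : c ≠ ∞) (x : Fin n → ℝ) :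
    hlM (fun y => c * f y) x = c * hlM f x := by
  simp only [hlM, cubeAvg, ENNReal.mul_iSup, lintegral_const_mul' _ _ hc, mul_div_assoc]

section Weights

variable {w : (Fin n → ℝ) → ℝ}

lemma exists_measurable_representative (hw : IsWeight w) :
    ∃ W : (Fin n → ℝ) → ℝ≥0∞, Measurable W ∧ (∀ x, W x ≠ 0) ∧ (∀ x, W x ≠ ∞) ∧
      (fun x => ENNReal.ofReal (w x)) =ᵐ[volume] W := by
  have hm := hw.1.aestronglyMeasurable.aemeasurable
  refine ⟨fun x => if 0 < hm.mk w x then ENNReal.ofReal (hm.mk w x) else 1, ?_, ?_, ?_, ?_⟩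
  · exact Measurable.ite (measurableSet_lt measurable_const hm.measurable_mk)
      hm.measurable_mk.ennreal_ofReal measurable_const
  · intro x
    dsimp only
    split_ifs with h
    · simpa using h
    · exact one_ne_zero
  · intro x
    dsimp only
    split_ifs with h
    · exact ENNReal.ofReal_ne_top
    · exact ENNReal.one_ne_top
  · filter_upwards [hw.2, hm.ae_eq_mk] with x h1 h2
    rw [← h2, if_pos h1]

lemma wMeas_cbox_ne_top (hw : IsWeight w) (a : Fin n → ℝ) (h : ℝ) : wMeas w (cbox a h) ≠ ∞ :=
  (hw.1.integrableOn_isCompact isCompact_Icc).lintegral_lt_top.ne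

lemma wMeas_cbox_ne_zero (hw : IsWeight w) (a : Fin n → ℝ) {h : ℝ} (hh : 0 < h) :
    wMeas w (cbox a h) ≠ 0 := by
  intro h0
  unfold wMeas at h0
  rw [lintegral_eq_zero_iff' hw.1.aestronglyMeasurable.aemeasurable.ennreal_ofReal.restrict] at h0
  have : volume (cbox a h) = 0 := by
    rw [← Measure.restrict_eq_zero, ← ae_eq_bot]
    by_contra hne
    have : (ae (volume.restrict (cbox a h))).NeBot := ⟨hne⟩
    obtain ⟨x, hx, hx'⟩ := (h0.and (ae_restrict_of_ae hw.2)).exists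
    simp only [Pi.zero_apply, ENNReal.ofReal_eq_zero] at hx
    linarith
  rw [← measure_congr (hbox_ae_eq_cbox a h)] at this
  exact volume_hbox_pos a hh this

lemma lintegral_hlM_le_aInfConst (hw : IsWeight w) (a : Fin n → ℝ) {h : ℝ} (hh : 0 < h) :
    ∫⁻ x in cbox a h, hlM ((cbox a h).indicator fun y => ENNReal.ofReal (w y)) x ≤
      aInfConst w * wMeas w (cbox a h) :=
  (ENNReal.div_le_iff (wMeas_cbox_ne_zero hw a hh) (wMeas_cbox_ne_top hw a h)).1
    (le_iSup₂_of_le (cbox a h) (isCube_cbox a hh) le_rfl)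

lemma AInfBound.of_isWeight (hw : IsWeight w) {W : (Fin n → ℝ) → ℝ≥0∞} (hW : Measurable W)
    (hW0 : ∀ x, W x ≠ 0) (hwW : (fun x => ENNReal.ofReal (w x)) =ᵐ[volume] W) :
    AInfBound W (aInfConst w) := by
  have hmass : ∀ (a : Fin n → ℝ) (h : ℝ), ∫⁻ y in hbox a h, W y = wMeas w (cbox a h) :=
    fun a h => by
      rw [setLIntegral_congr (hbox_ae_eq_cbox a h)]
      exact lintegral_congr_ae (ae_restrict_of_ae hwW.symm)
  refine ⟨hW, hW0, fun a h => ?_, fun a h hh => ?_⟩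
  · rw [hmass]
    exact wMeas_cbox_ne_top hw a h
  · rw [hmass]
    refine le_trans (le_of_eq ?_) (lintegral_hlM_le_aInfConst hw a hh)
    rw [setLIntegral_congr (hbox_ae_eq_cbox a h)]
    have : (hbox a h).indicator W =ᵐ[volume]
        (cbox a h).indicator fun y => ENNReal.ofReal (w y) :=
      (indicator_ae_eq_of_ae_eq_set (hbox_ae_eq_cbox a h)).trans (by
        filter_upwards [hwW] with x hx
        by_cases hxQ : x ∈ cbox a h
        · rw [indicator_of_mem hxQ, indicator_of_mem hxQ, hx]
        · rw [indicator_of_notMem hxQ, indicator_of_notMem hxQ])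
    rw [hlM_congr this]

lemma hlM_le_a1Const (hw : IsWeight w) :
    ∀ᵐ x, hlM (fun y => ENNReal.ofReal (w y)) x ≤ a1Const w * ENNReal.ofReal (w x) := by
  filter_upwards [ENNReal.ae_le_essSup (μ := volume) fun x =>
    hlM (fun y => ENNReal.ofReal (w y)) x / ENNReal.ofReal (w x), hw.2] with x hx hx0
  exact (ENNReal.div_le_iff (by simpa using hx0) ENNReal.ofReal_ne_top).1 hx

lemma aInfConst_le_a1Const (hw : IsWeight w) (hfin : a1Const w ≠ ∞) :
    aInfConst w ≤ a1Const w := by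
  refine iSup₂_le fun Q _ => ENNReal.div_le_of_le_mul ?_
  unfold wMeas
  rw [← lintegral_const_mul' _ _ hfin]
  refine lintegral_mono_ae (ae_restrict_of_ae ?_)
  filter_upwards [hlM_le_a1Const hw] with x hx
  refine le_trans (hlM_mono (fun y => ?_) x) hx
  exact indicator_le_self' (fun _ _ => zero_le) y

lemma one_le_aInfConst (hw : IsWeight w) : 1 ≤ aInfConst w := by
  let Q : Set (Fin n → ℝ) := cbox 0 1
  have hQ : IsCube Q := isCube_cbox 0 one_pos
  have hQm : MeasurableSet Q := measurableSet_cbox 0 1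
  have hvol : volume Q = 1 := by rw [volume_cbox]; simp
  have h1 : wMeas w Q ≤
      ∫⁻ x in Q, hlM (Q.indicator fun y => ENNReal.ofReal (w y)) x := by
    calc wMeas w Q = ∫⁻ _ in Q, wMeas w Q := by rw [setLIntegral_const, hvol, mul_one]
      _ ≤ _ := by
        refine setLIntegral_mono' hQm fun x hx => ?_
        refine le_trans (le_of_eq ?_) (le_iSup_of_le Q (le_iSup₂_of_le hQ hx le_rfl))
        rw [cubeAvg, hvol, div_one, setLIntegral_indicator hQm, inter_self]
        rfl
  refine le_trans ?_ (le_iSup₂_of_le Q hQ le_rfl)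
  rw [ENNReal.le_div_iff_mul_le (Or.inl (wMeas_cbox_ne_zero hw 0 one_pos))
    (Or.inl (wMeas_cbox_ne_top hw 0 1)), one_mul]
  exact h1

end Weights

lemma constant_le (n N M : ℕ) {K B : ℝ} (hK : 1 ≤ K) (hB : 1 ≤ B)
    (hN : (N : ℝ) ≤ 2 ^ (n + 3) * K) (hM : (M : ℝ) ≤ 2 ^ (n + 3) * B) :
    12 ^ n * 256 * (((n * 2 ^ (2 * (M + 1)) + 3) * 2 ^ (2 * (M + 1)) * (N + 1) + 1 : ℕ) : ℝ) ≤
      12 ^ n * 256 * (n + 4) * 2 ^ (n + 4) *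
        (K * Real.exp (12 ^ n * 256 * (n + 4) * 2 ^ (n + 4) * B)) := by
  have h1 : (1 : ℝ) ≤ 2 ^ (n + 3) := one_le_pow₀ (by norm_num)
  have h2 : (2 : ℝ) ^ (n + 4) = 2 * 2 ^ (n + 3) := by ring
  have hx1 : (1 : ℝ) ≤ 2 ^ (n + 3) * K := one_le_mul_of_one_le_of_one_le h1 hK
  have hx2 : (1 : ℝ) ≤ 2 ^ (n + 3) * B := one_le_mul_of_one_le_of_one_le h1 hB
  set p : ℝ := 2 ^ (2 * (M + 1)) with hp
  have hp1 : 1 ≤ p := one_le_pow₀ (by norm_num)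
  have hN1 : (N : ℝ) + 1 ≤ 2 ^ (n + 4) * K := by rw [h2]; linarith
  have hpexp : p * p ≤ Real.exp (12 ^ n * 256 * (n + 4) * 2 ^ (n + 4) * B) := by
    have he : (2 : ℝ) ≤ Real.exp 1 := by linarith [Real.add_one_le_exp (1 : ℝ)]
    calc p * p = 2 ^ (4 * (M + 1)) := by rw [hp, ← pow_add]; congr 1; ring
      _ ≤ Real.exp 1 ^ (4 * (M + 1)) := by gcongr
      _ = Real.exp ((4 * (M + 1) : ℕ) : ℝ) := by rw [← Real.exp_nat_mul, mul_one]
      _ ≤ _ := by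
        refine Real.exp_le_exp.2 ?_
        push_cast
        have h3 : (4 : ℝ) ≤ 12 ^ n * 256 * (n + 4) := by
          have : (1 : ℝ) ≤ 12 ^ n := one_le_pow₀ (by norm_num)
          nlinarith [show (0 : ℝ) ≤ n from n.cast_nonneg]
        calc (4 : ℝ) * (M + 1) ≤ 4 * (2 ^ (n + 4) * B) := by rw [h2]; linarith
          _ ≤ 12 ^ n * 256 * (n + 4) * (2 ^ (n + 4) * B) := by gcongr
          _ = _ := by ring
  have hZ : ((n * p + 3) * p * (N + 1) + 1 : ℝ) ≤ (n + 4) * (p * p) * (N + 1) := by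
    have h3 : (n * p + 3) * p ≤ (n + 3) * (p * p) := by nlinarith
    have h4 : (1 : ℝ) ≤ p * p * (N + 1) :=
      one_le_mul_of_one_le_of_one_le (one_le_mul_of_one_le_of_one_le hp1 hp1) (by simp)
    have h5 := mul_le_mul_of_nonneg_right h3 (show (0 : ℝ) ≤ N + 1 by positivity)
    linarith
  push_cast
  rw [← hp]
  calc 12 ^ n * 256 * ((n * p + 3) * p * (N + 1) + 1)
      ≤ 12 ^ n * 256 * ((n + 4) * (p * p) * (N + 1)) := by gcongr
    _ ≤ 12 ^ n * 256 * ((n + 4) * Real.exp (12 ^ n * 256 * (n + 4) * 2 ^ (n + 4) * B) *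
        (2 ^ (n + 4) * K)) := by gcongr
    _ = _ := by ring

lemma exists_nat_two_pow_mul_le {K : ℝ≥0∞} (hK1 : 1 ≤ K) (hK : K ≠ ∞) :
    ∃ N : ℕ, N ≠ 0 ∧ 2 ^ (n + 2) * K ≤ N ∧ (N : ℝ) ≤ 2 ^ (n + 3) * K.toReal := by
  have hr : 1 ≤ K.toReal := by
    have := ENNReal.toReal_mono hK hK1
    simpa using this
  have h1 : (1 : ℝ) ≤ 2 ^ (n + 2) := one_le_pow₀ (by norm_num)
  have hx : (1 : ℝ) ≤ 2 ^ (n + 2) * K.toReal := one_le_mul_of_one_le_of_one_le h1 hr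
  refine ⟨⌈2 ^ (n + 2) * K.toReal⌉₊, ?_, ?_, ?_⟩
  · exact (Nat.ceil_pos.2 (by linarith)).ne'
  · rw [← ENNReal.ofReal_toReal hK, ← ENNReal.ofReal_natCast,
      show (2 : ℝ≥0∞) = ENNReal.ofReal 2 by norm_num, ← ENNReal.ofReal_pow (by norm_num),
      ← ENNReal.ofReal_mul (by positivity)]
    refine ENNReal.ofReal_le_ofReal ?_
    rw [ENNReal.toReal_ofReal ENNReal.toReal_nonneg]
    exact Nat.le_ceil _
  · have h2 := (Nat.ceil_lt_add_one (show 0 ≤ 2 ^ (n + 2) * K.toReal by positivity)).le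
    rw [show (2 : ℝ) ^ (n + 3) = 2 * 2 ^ (n + 2) by ring]
    linarith

/-- The weak-type estimate in terms of auxiliary integer bounds for the `A_∞` constants. -/
lemma wkNorm_le {u v f : (Fin n → ℝ) → ℝ} (hu : IsWeight u) (hv : IsWeight v)
    (hf : Measurable f) {N M : ℕ} (hN0 : N ≠ 0) (hM0 : M ≠ 0)
    (hN : 2 ^ (n + 2) * aInfConst u ≤ N) (hM : 2 ^ (n + 2) * aInfConst v ≤ M) :
    wkNorm (fun x => hlMR (fun y => f y * v y) x / ENNReal.ofReal (v x))
        (fun x => u x * v x) ≤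
      a1Const u * aInfConst v * (12 ^ n * 256 *
        ((n * 2 ^ (2 * (M + 1)) + 3) * 2 ^ (2 * (M + 1)) * (N + 1) + 1 : ℕ)) *
        l1Norm f (fun x => u x * v x) := by
  obtain ⟨U, hUm, hU0, -, huU⟩ := exists_measurable_representative hu
  obtain ⟨V, hVm, hV0, hVt, hvV⟩ := exists_measurable_representative hv
  have hU := AInfBound.of_isWeight hu hUm hU0 huU
  have hV := AInfBound.of_isWeight hv hVm hV0 hvV
  have hA : ∀ᵐ x, hlM U x ≤ a1Const u * U x := by
    rw [← hlM_congr huU]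
    filter_upwards [hlM_le_a1Const hu, huU] with x h1 h2
    rwa [← h2]
  have huv : (fun x => ENNReal.ofReal (u x * v x)) =ᵐ[volume] fun x => U x * V x := by
    filter_upwards [huU, hvV, hu.2] with x h1 h2 h3
    rw [ENNReal.ofReal_mul h3.le, ← h1, ← h2]
  have hfv : (fun y => ENNReal.ofReal |f y * v y|) =ᵐ[volume]
      fun y => ENNReal.ofReal |f y| * V y := by
    filter_upwards [hvV, hv.2] with x h1 h2
    rw [abs_mul, ENNReal.ofReal_mul (abs_nonneg _), abs_of_pos h2, h1]
  have hFm : Measurable fun y => ENNReal.ofReal |f y| :=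
    (_root_.measurable_abs.comp hf).ennreal_ofReal
  set F : (Fin n → ℝ) → ℝ≥0∞ := fun y => ENNReal.ofReal |f y|
  have hl1 : l1Norm f (fun x => u x * v x) = ∫⁻ x, F x * V x * U x := by
    refine lintegral_congr_ae ?_
    filter_upwards [huv] with x hx
    rw [hx]
    ring
  rw [hl1]
  refine iSup₂_le fun t ht => ?_
  have ht0 : (t : ℝ≥0∞) ≠ 0 := by exact_mod_cast ht.ne'
  have htt : (t : ℝ≥0∞) ≠ ∞ := ENNReal.coe_ne_top
  set G : (Fin n → ℝ) → ℝ≥0∞ := fun y => (t : ℝ≥0∞)⁻¹ * (F y * V y)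
  have hGm : Measurable G := (hFm.mul hVm).const_mul _
  have hset : {x | (t : ℝ≥0∞) < hlMR (fun y => f y * v y) x / ENNReal.ofReal (v x)} =ᵐ[volume]
      {x | V x < hlM G x} := by
    filter_upwards [hvV] with x hx
    refine propext ?_
    change (t : ℝ≥0∞) < hlM (fun y => ENNReal.ofReal |f y * v y|) x / ENNReal.ofReal (v x) ↔
      V x < hlM G x
    rw [hlM_congr hfv, hx, hlM_const_mul _ (ENNReal.inv_ne_top.2 ht0),
      ENNReal.lt_div_iff_mul_lt (Or.inl (hV0 x)) (Or.inl (hVt x)), mul_comm (t : ℝ≥0∞)⁻¹,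
      ← div_eq_mul_inv, ENNReal.lt_div_iff_mul_lt (Or.inl ht0) (Or.inl htt), mul_comm]
  have hmeas : wMeas (fun x => u x * v x)
      {x | (t : ℝ≥0∞) < hlMR (fun y => f y * v y) x / ENNReal.ofReal (v x)} =
      ∫⁻ x in {x | V x < hlM G x}, U x * V x := by
    unfold wMeas
    rw [setLIntegral_congr hset]
    exact lintegral_congr_ae (ae_restrict_of_ae huv)
  rw [hmeas]
  refine (mul_le_mul_right (lintegral_hlM_gt_le hGm hU hV hVt hA hN0 hN
    (hV.halfSmall hM0 hM)) _).trans (le_of_eq ?_)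
  have hGI : ∫⁻ x, G x * U x = (t : ℝ≥0∞)⁻¹ * ∫⁻ x, F x * V x * U x := by
    rw [← lintegral_const_mul' _ _ (ENNReal.inv_ne_top.2 ht0)]
    exact lintegral_congr fun x => mul_assoc _ _ _
  rw [hGI, show (12 : ℝ≥0∞) = 2 * 6 by norm_num, mul_pow]
  generalize (((n * 2 ^ (2 * (M + 1)) + 3) * 2 ^ (2 * (M + 1)) * (N + 1) + 1 : ℕ) : ℝ≥0∞) = Z
  generalize ∫⁻ x, F x * V x * U x = I
  calc _ = ((t : ℝ≥0∞) * (t : ℝ≥0∞)⁻¹) * (a1Const u * aInfConst v * (2 ^ n * 6 ^ n * 256 * Z) * I) := by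
        ring
    _ = _ := by rw [ENNReal.mul_inv_cancel ht0 htt, one_mul]

end MixedWeak

end

/-- **Quantitative mixed weak-type bound for `v ∈ A_∞`, `u ∈ A₁`.**
`‖M(fv)/v‖_{L^{1,∞}(uv)} ≤ c_n [u]_{A₁}[v]_{A_∞}([u]_{A₁}[v]_{A_∞} + [u]_{A_∞} e^{c_n [v]_{A_∞}}) ‖f‖_{L¹(uv)}`. -/
theorem quantitative_mixed_bound_Ainfty (n : ℕ) :
    ∃ c : ℝ≥0, 0 < c ∧
      ∀ u v : (Fin n → ℝ) → ℝ, IsWeight u → IsWeight v →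
        a1Const u ≠ ∞ → aInfConst v ≠ ∞ →
        ∀ f : (Fin n → ℝ) → ℝ, Measurable f →
          l1Norm f (fun x => u x * v x) ≠ ∞ →
          wkNorm (fun x => hlMR (fun y => f y * v y) x / ENNReal.ofReal (v x))
              (fun x => u x * v x) ≤
            (c : ℝ≥0∞) * a1Const u * aInfConst v *
              (a1Const u * aInfConst v +
                aInfConst u *
                  ENNReal.ofReal (Real.exp ((c : ℝ) * (aInfConst v).toReal))) *
              l1Norm f (fun x => u x * v x) := by
  have hc : (0 : ℝ) < 12 ^ n * 256 * (n + 4) * 2 ^ (n + 4) := by positivity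
  refine ⟨Real.toNNReal (12 ^ n * 256 * (n + 4) * 2 ^ (n + 4)), Real.toNNReal_pos.2 hc, ?_⟩
  intro u v hu hv hu1 hv1 f hf _
  have hK1 := MixedWeak.one_le_aInfConst hu
  have hB1 := MixedWeak.one_le_aInfConst hv
  have hK : aInfConst u ≠ ∞ := ne_top_of_le_ne_top hu1 (MixedWeak.aInfConst_le_a1Const hu hu1)
  obtain ⟨N, hN0, hN, hN'⟩ := MixedWeak.exists_nat_two_pow_mul_le (n := n) hK1 hK
  obtain ⟨M, hM0, hM, hM'⟩ := MixedWeak.exists_nat_two_pow_mul_le (n := n) hB1 hv1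
  have hKr : 1 ≤ (aInfConst u).toReal := by simpa using ENNReal.toReal_mono hK hK1
  have hBr : 1 ≤ (aInfConst v).toReal := by simpa using ENNReal.toReal_mono hv1 hB1
  refine (MixedWeak.wkNorm_le hu hv hf hN0 hM0 hN hM).trans ?_
  gcongr ?_ * _
  have hconst := ENNReal.ofReal_le_ofReal (MixedWeak.constant_le n N M hKr hBr hN' hM')
  rw [ENNReal.ofReal_mul (by positivity), ENNReal.ofReal_natCast, ENNReal.ofReal_mul hc.le,
    ENNReal.ofReal_mul ENNReal.toReal_nonneg, ENNReal.ofReal_toReal hK,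
    ENNReal.ofReal_mul (by positivity), ENNReal.ofReal_pow (by norm_num),
    ENNReal.ofReal_ofNat, ENNReal.ofReal_ofNat] at hconst
  refine (mul_le_mul_right hconst _).trans ?_
  rw [Real.coe_toNNReal _ hc.le]
  calc _ = ENNReal.ofReal (12 ^ n * 256 * (n + 4) * 2 ^ (n + 4)) * a1Const u * aInfConst v *
        (aInfConst u * ENNReal.ofReal
          (Real.exp (12 ^ n * 256 * (n + 4) * 2 ^ (n + 4) * (aInfConst v).toReal))) := by ring
    _ ≤ _ := by
      refine mul_le_mul_right ?_ _
      exact le_add_self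
end
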